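/- arXiv:2007.13532 — 9 statements merged into one kernel-verified Lean document; each statement's English description precedes it below -/
import Mathlib

section
/- Second Order Oracle Bound: in multiclass classification, the expected zero-one loss of the ρ-weighted majority vote satisfies L(MV_ρ) ≤ 4·E_{ρ²}[L(h,h')]. -/
open MeasureTheory Finset

/-- If a weighted plurality label `m` differs from `y`, then at least half of the weight is on
voters not choosing `y`. -/
theorem half_le_weight_ne_of_plurality {Y H : Type*} [DecidableEq Y] [Fintype H]
    (vote : H → Y) (ρ : H → ℝ) (hρ0 : ∀ i, 0 ≤ ρ i) (hρ1 : ∑ i, ρ i = 1) {m y : Y} (hne : m ≠ y)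
    (hle : (∑ i, ρ i * (if vote i = y then (1 : ℝ) else 0)) ≤
      ∑ i, ρ i * (if vote i = m then (1 : ℝ) else 0)) :
    1 / 2 ≤ ∑ i, ρ i * (if vote i ≠ y then (1 : ℝ) else 0) := by
  have hsum : (∑ i, ρ i * (if vote i ≠ y then (1 : ℝ) else 0)) +
      ∑ i, ρ i * (if vote i = y then (1 : ℝ) else 0) = 1 := by
    rw [← sum_add_distrib]
    refine Eq.trans ?_ hρ1
    refine sum_congr rfl fun i _ => ?_
    by_cases h : vote i = y <;> simp [h]
  have hm : (∑ i, ρ i * (if vote i = m then (1 : ℝ) else 0)) ≤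
      ∑ i, ρ i * (if vote i ≠ y then (1 : ℝ) else 0) := by
    refine sum_le_sum fun i _ => mul_le_mul_of_nonneg_left ?_ (hρ0 i)
    by_cases h : vote i = m
    · simp [h, hne]
    · rw [if_neg h]
      positivity
  linarith


/-- Second Order Oracle Bound: `L(MV_ρ) ≤ 4 E_{ρ²}[L(h,h')]`. -/
theorem second_order_oracle_bound
    {X Y H : Type*} [MeasurableSpace X] [MeasurableSpace Y] [MeasurableSingletonClass Y]
    [Fintype Y] [Nonempty Y] [DecidableEq Y] [Fintype H]
    (D : Measure (X × Y)) [IsProbabilityMeasure D]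
    (hyp : H → X → Y) (hmeas : ∀ i, Measurable (hyp i))
    (ρ : H → ℝ) (hρ0 : ∀ i, 0 ≤ ρ i) (hρ1 : ∑ i, ρ i = 1)
    (MV : X → Y) (hMVmeas : Measurable MV)
    (hMV : ∀ x y, (∑ i, ρ i * (if hyp i x = y then (1:ℝ) else 0)) ≤
        ∑ i, ρ i * (if hyp i x = MV x then (1:ℝ) else 0)) :
    (D {p : X × Y | MV p.1 ≠ p.2}).toReal ≤
      4 * ∑ i, ∑ j, ρ i * ρ j *
        (D {p : X × Y | hyp i p.1 ≠ p.2 ∧ hyp j p.1 ≠ p.2}).toReal := by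
  have herr {f : X → Y} (hf : Measurable f) : MeasurableSet {p : X × Y | f p.1 ≠ p.2} :=
    (measurableSet_eq_fun (hf.comp measurable_fst) measurable_snd).compl
  have htandem (i j : H) :
      MeasurableSet {p : X × Y | hyp i p.1 ≠ p.2 ∧ hyp j p.1 ≠ p.2} :=
    (herr (hmeas i)).inter (herr (hmeas j))
  have hint {s : Set (X × Y)} (hs : MeasurableSet s) :
      Integrable (s.indicator (1 : X × Y → ℝ)) D :=
    (integrable_const (1 : ℝ)).indicator hs
  have hterm (i j : H) : Integrable (fun p => ρ i * ρ j *
      {p : X × Y | hyp i p.1 ≠ p.2 ∧ hyp j p.1 ≠ p.2}.indicator (1 : X × Y → ℝ) p) D :=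
    (hint (htandem i j)).const_mul _
  have hpointwise (p : X × Y) : {p : X × Y | MV p.1 ≠ p.2}.indicator (1 : X × Y → ℝ) p ≤
      4 * ∑ i, ∑ j, ρ i * ρ j *
        {p : X × Y | hyp i p.1 ≠ p.2 ∧ hyp j p.1 ≠ p.2}.indicator (1 : X × Y → ℝ) p := by
    have hsq : ∑ i, ∑ j, ρ i * ρ j *
        {p : X × Y | hyp i p.1 ≠ p.2 ∧ hyp j p.1 ≠ p.2}.indicator (1 : X × Y → ℝ) p =
        (∑ i, ρ i * (if hyp i p.1 ≠ p.2 then (1 : ℝ) else 0)) ^ 2 := by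
      rw [sq, sum_mul_sum]
      refine sum_congr rfl fun i _ => sum_congr rfl fun j _ => ?_
      by_cases hi : hyp i p.1 = p.2 <;> by_cases hj : hyp j p.1 = p.2 <;> simp [hi, hj]
    rw [hsq]
    by_cases h : MV p.1 = p.2
    · rw [Set.indicator_of_notMem (by simpa using h)]
      positivity
    · rw [Set.indicator_of_mem (by simpa using h), Pi.one_apply]
      nlinarith [half_le_weight_ne_of_plurality (hyp · p.1) ρ hρ0 hρ1 h (hMV p.1 p.2)]
  calc (D {p : X × Y | MV p.1 ≠ p.2}).toReal
      = ∫ p, {p : X × Y | MV p.1 ≠ p.2}.indicator (1 : X × Y → ℝ) p ∂D :=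
        (integral_indicator_one (herr hMVmeas)).symm
    _ ≤ ∫ p, 4 * ∑ i, ∑ j, ρ i * ρ j *
          {p : X × Y | hyp i p.1 ≠ p.2 ∧ hyp j p.1 ≠ p.2}.indicator (1 : X × Y → ℝ) p ∂D :=
        integral_mono (hint (herr hMVmeas))
          ((integrable_finsetSum _ fun i _ =>
            integrable_finsetSum _ fun j _ => hterm i j).const_mul 4) hpointwise
    _ = _ := by
        rw [integral_const_mul, integral_finsetSum _ fun i _ =>
          integrable_finsetSum _ fun j _ => hterm i j]
        congr 1
        refine sum_congr rfl fun i _ => ?_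
        rw [integral_finsetSum _ fun j _ => hterm i j]
        refine sum_congr rfl fun j _ => ?_
        rw [integral_const_mul, integral_indicator_one (htandem i j), measureReal_def]
end

section
/- In binary classification, the ρ²-expected tandem loss decomposes as E_{ρ²}[L(h,h')] = E_ρ[L(h)] − (1/2)·E_{ρ²}[𝔻(h,h')]. -/
open MeasureTheory Finset

open scoped symmDiff

/-- With two labels, two predictions differ iff exactly one of them is wrong. -/
lemma setOf_ne_eq_symmDiff {α Y : Type*} [Fintype Y] (hY : Fintype.card Y = 2) (f g y : α → Y) :
    {a | f a ≠ g a} = {a | f a ≠ y a} ∆ {a | g a ≠ y a} := by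
  classical
  obtain ⟨u, v, -, huv⟩ := Finset.card_eq_two.mp (Finset.card_univ.trans hY)
  have key (c : Y) : c = u ∨ c = v := by simpa [huv] using Finset.mem_univ c
  ext a
  simp only [Set.mem_symmDiff, Set.mem_ofPred_eq]
  have hf := key (f a)
  have hg := key (g a)
  have hy := key (y a)
  grind

/-- The losses of two binary classifiers add up to twice the tandem loss plus the disagreement. -/
lemma measureReal_ne_add_measureReal_ne {α Y : Type*} [MeasurableSpace α] [MeasurableSpace Y]
    [MeasurableSingletonClass Y] [Fintype Y] (hY : Fintype.card Y = 2)
    (μ : Measure α) [IsFiniteMeasure μ] {f g y : α → Y}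
    (hf : Measurable f) (hg : Measurable g) (hy : Measurable y) :
    μ.real {a | f a ≠ y a} + μ.real {a | g a ≠ y a} =
      2 * μ.real {a | f a ≠ y a ∧ g a ≠ y a} + μ.real {a | f a ≠ g a} := by
  have hA : MeasurableSet {a | f a ≠ y a} := (measurableSet_eq_fun hf hy).compl
  have hB : MeasurableSet {a | g a ≠ y a} := (measurableSet_eq_fun hg hy).compl
  have hfg := measureReal_inter_add_sdiff (μ := μ) (s := {a | f a ≠ y a}) hB
  have hgf := measureReal_inter_add_sdiff (μ := μ) (s := {a | g a ≠ y a}) hA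
  rw [Set.inter_comm] at hgf
  rw [setOf_ne_eq_symmDiff hY f g y, measureReal_symmDiff_eq hA hB, Set.ofPred_and]
  linarith

/-- Averaging the identity `L i + L j = 2 * T i j + K i j` over independent pairs of indices. -/
lemma sum_sum_mul_eq_sub_half {ι : Type*} [Fintype ι] {ρ L : ι → ℝ} {T K : ι → ι → ℝ}
    (hρ : ∑ i, ρ i = 1) (h : ∀ i j, L i + L j = 2 * T i j + K i j) :
    ∑ i, ∑ j, ρ i * ρ j * T i j =
      ∑ i, ρ i * L i - (1 / 2) * ∑ i, ∑ j, ρ i * ρ j * K i j := by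
  have hT (i j : ι) : ρ i * ρ j * T i j =
      (1 / 2) * (ρ i * L i * ρ j) + (1 / 2) * (ρ i * (ρ j * L j)) -
        (1 / 2) * (ρ i * ρ j * K i j) := by
    linear_combination (-(1 / 2) * ρ i * ρ j) * h i j
  simp only [hT, sum_sub_distrib, sum_add_distrib, ← mul_sum, ← sum_mul, hρ]
  ring

/-- In binary classification the ρ²-expected tandem loss decomposes as
`E_{ρ²}[L(h,h')] = E_ρ[L(h)] - (1/2) E_{ρ²}[𝔻(h,h')]`. -/
theorem tandem_loss_decomposition_binary
    {X Y H : Type*} [MeasurableSpace X] [MeasurableSpace Y] [MeasurableSingletonClass Y]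
    [Fintype Y] (hY : Fintype.card Y = 2) [DecidableEq Y] [Fintype H]
    (D : Measure (X × Y)) [IsProbabilityMeasure D]
    (hyp : H → X → Y) (hmeas : ∀ i, Measurable (hyp i))
    (ρ : H → ℝ) (hρ0 : ∀ i, 0 ≤ ρ i) (hρ1 : ∑ i, ρ i = 1) :
    (∑ i, ∑ j, ρ i * ρ j *
        (D {p : X × Y | hyp i p.1 ≠ p.2 ∧ hyp j p.1 ≠ p.2}).toReal) =
      (∑ i, ρ i * (D {p : X × Y | hyp i p.1 ≠ p.2}).toReal) -
        (1/2) * ∑ i, ∑ j, ρ i * ρ j *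
          (D {p : X × Y | hyp i p.1 ≠ hyp j p.1}).toReal := by
  exact sum_sum_mul_eq_sub_half hρ1 fun i j ↦
    measureReal_ne_add_measureReal_ne hY D ((hmeas i).comp measurable_fst)
      ((hmeas j).comp measurable_fst) measurable_snd
end

section
/- Second Order Oracle Bound for Binary Classification: in binary classification, the expected zero-one loss of the ρ-weighted majority vote satisfies L(MV_ρ) ≤ 4·E_ρ[L(h)] − 2·E_{ρ²}[𝔻(h,h')]. -/
open MeasureTheory Finset

/-- In a type with two elements, two elements different from a third one agree. -/
lemma eq_of_ne_of_ne_of_card_eq_two {Y : Type*} [Fintype Y] (hY : Fintype.card Y = 2)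
    {a b c : Y} (ha : a ≠ c) (hb : b ≠ c) : a = b := by
  by_contra hab
  have h : 2 < Fintype.card Y := Fintype.two_lt_card_iff.mpr ⟨a, b, c, hab, ha, hb⟩
  omega

/-- The weighted disagreement of a family of votes over two labels, in terms of the weighted
error `w` with respect to a label `y`, is `2 w (1 - w)`. -/
lemma sum_mul_disagreement_eq {Y H : Type*} [Fintype Y] (hY : Fintype.card Y = 2)
    [DecidableEq Y] [Fintype H] (v : H → Y) (ρ : H → ℝ) (hρ1 : ∑ i, ρ i = 1) (y : Y) :
    ∑ i, ∑ j, ρ i * ρ j * (if v i ≠ v j then (1 : ℝ) else 0) =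
      2 * (∑ i, ρ i * (if v i ≠ y then (1 : ℝ) else 0)) *
        (1 - ∑ i, ρ i * (if v i ≠ y then (1 : ℝ) else 0)) := by
  have hpt : ∀ i j, ρ i * ρ j * (if v i ≠ v j then (1 : ℝ) else 0) =
      (ρ i * (if v i ≠ y then (1 : ℝ) else 0)) * ρ j
        + ρ i * (ρ j * (if v j ≠ y then (1 : ℝ) else 0))
        - 2 * ((ρ i * (if v i ≠ y then (1 : ℝ) else 0)) *
          (ρ j * (if v j ≠ y then (1 : ℝ) else 0))) := by
    intro i j
    by_cases hi : v i = y
    · by_cases hj : v j = y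
      · simp [hi, hj]
      · simp [hi, hj, Ne.symm hj]
    · by_cases hj : v j = y
      · simp [hi, hj]
      · simp [eq_of_ne_of_ne_of_card_eq_two hY hi hj, hj]
        ring
  simp_rw [hpt, Finset.sum_sub_distrib, Finset.sum_add_distrib, ← Finset.mul_sum,
    ← Finset.sum_mul, hρ1]
  ring

/-- If a plurality label `m` of a weighted vote over two labels differs from `y`, then the
weighted error with respect to `y` is at least `1 / 2`. -/
lemma half_le_weighted_error {Y H : Type*} [Fintype Y] (hY : Fintype.card Y = 2)
    [DecidableEq Y] [Fintype H] (v : H → Y) (ρ : H → ℝ) (hρ1 : ∑ i, ρ i = 1) {m y : Y}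
    (hm : (∑ i, ρ i * (if v i = y then (1 : ℝ) else 0)) ≤
      ∑ i, ρ i * (if v i = m then (1 : ℝ) else 0)) (hne : m ≠ y) :
    1 / 2 ≤ ∑ i, ρ i * (if v i ≠ y then (1 : ℝ) else 0) := by
  have hsum : (∑ i, ρ i * (if v i = y then (1 : ℝ) else 0)) +
      ∑ i, ρ i * (if v i ≠ y then (1 : ℝ) else 0) = 1 := by
    rw [← Finset.sum_add_distrib]
    refine (Finset.sum_congr rfl fun i _ => ?_).trans hρ1
    by_cases h : v i = y <;> simp [h]
  have heq : (∑ i, ρ i * (if v i = m then (1 : ℝ) else 0)) =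
      ∑ i, ρ i * (if v i ≠ y then (1 : ℝ) else 0) := by
    refine Finset.sum_congr rfl fun i _ => ?_
    by_cases h : v i = y
    · simp [h, hne.symm]
    · simp [eq_of_ne_of_ne_of_card_eq_two hY h hne, hne]
  linarith

/-- Second Order Oracle Bound for Binary Classification:
`L(MV_ρ) ≤ 4 E_ρ[L(h)] - 2 E_{ρ²}[𝔻(h,h')]`. -/
theorem second_order_oracle_bound_binary
    {X Y H : Type*} [MeasurableSpace X] [MeasurableSpace Y] [MeasurableSingletonClass Y]
    [Fintype Y] (hY : Fintype.card Y = 2) [DecidableEq Y] [Fintype H]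
    (D : Measure (X × Y)) [IsProbabilityMeasure D]
    (hyp : H → X → Y) (hmeas : ∀ i, Measurable (hyp i))
    (ρ : H → ℝ) (hρ0 : ∀ i, 0 ≤ ρ i) (hρ1 : ∑ i, ρ i = 1)
    (MV : X → Y) (hMVmeas : Measurable MV)
    (hMV : ∀ x y, (∑ i, ρ i * (if hyp i x = y then (1:ℝ) else 0)) ≤
        ∑ i, ρ i * (if hyp i x = MV x then (1:ℝ) else 0)) :
    (D {p : X × Y | MV p.1 ≠ p.2}).toReal ≤
      4 * (∑ i, ρ i * (D {p : X × Y | hyp i p.1 ≠ p.2}).toReal) -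
        2 * ∑ i, ∑ j, ρ i * ρ j *
          (D {p : X × Y | hyp i p.1 ≠ hyp j p.1}).toReal := by
  have hint : ∀ f g : X × Y → Y, Measurable f → Measurable g →
      Integrable (fun p => if f p ≠ g p then (1 : ℝ) else 0) D ∧
        (D {p | f p ≠ g p}).toReal = ∫ p, (if f p ≠ g p then (1 : ℝ) else 0) ∂D := by
    intro f g hf hg
    have hs : MeasurableSet {p | f p ≠ g p} := (measurableSet_eq_fun hf hg).compl
    have hind : (fun p => if f p ≠ g p then (1 : ℝ) else 0) =
        {p | f p ≠ g p}.indicator 1 := by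
      ext p
      simp [Set.indicator_apply]
    rw [hind]
    exact ⟨(integrable_const (1 : ℝ)).indicator hs, (integral_indicator_one hs).symm⟩
  have hMVi := hint (fun p => MV p.1) Prod.snd (hMVmeas.comp measurable_fst) measurable_snd
  have herr := fun i => hint (fun p => hyp i p.1) Prod.snd
    ((hmeas i).comp measurable_fst) measurable_snd
  have hdis := fun i j => hint (fun p => hyp i p.1) (fun p => hyp j p.1)
    ((hmeas i).comp measurable_fst) ((hmeas j).comp measurable_fst)
  have herrI : Integrable
      (fun p : X × Y => ∑ i, ρ i * (if hyp i p.1 ≠ p.2 then (1 : ℝ) else 0)) D :=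
    integrable_finsetSum _ fun i _ => (herr i).1.const_mul _
  have hdisI : ∀ i, Integrable (fun p : X × Y =>
      ∑ j, ρ i * ρ j * (if hyp i p.1 ≠ hyp j p.1 then (1 : ℝ) else 0)) D :=
    fun i => integrable_finsetSum _ fun j _ => (hdis i j).1.const_mul _
  have hdisII : Integrable (fun p : X × Y =>
      ∑ i, ∑ j, ρ i * ρ j * (if hyp i p.1 ≠ hyp j p.1 then (1 : ℝ) else 0)) D :=
    integrable_finsetSum _ fun i _ => hdisI i
  have hE : ∑ i, ρ i * (D {p : X × Y | hyp i p.1 ≠ p.2}).toReal =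
      ∫ p : X × Y, ∑ i, ρ i * (if hyp i p.1 ≠ p.2 then (1 : ℝ) else 0) ∂D := by
    rw [integral_finsetSum _ fun i _ => (herr i).1.const_mul _]
    refine Finset.sum_congr rfl fun i _ => ?_
    rw [integral_const_mul, (herr i).2]
  have hDD : ∑ i, ∑ j, ρ i * ρ j * (D {p : X × Y | hyp i p.1 ≠ hyp j p.1}).toReal =
      ∫ p : X × Y,
        ∑ i, ∑ j, ρ i * ρ j * (if hyp i p.1 ≠ hyp j p.1 then (1 : ℝ) else 0) ∂D := by
    rw [integral_finsetSum _ fun i _ => hdisI i]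
    refine Finset.sum_congr rfl fun i _ => ?_
    rw [integral_finsetSum _ fun j _ => (hdis i j).1.const_mul _]
    refine Finset.sum_congr rfl fun j _ => ?_
    rw [integral_const_mul, (hdis i j).2]
  rw [hMVi.2, hE, hDD, ← integral_const_mul, ← integral_const_mul,
    ← integral_sub (herrI.const_mul 4) (hdisII.const_mul 2)]
  refine integral_mono hMVi.1 ((herrI.const_mul 4).sub (hdisII.const_mul 2)) fun p => ?_
  dsimp only
  rw [sum_mul_disagreement_eq hY (fun i => hyp i p.1) ρ hρ1 p.2]
  split_ifs with h
  · have hw := half_le_weighted_error hY (fun i => hyp i p.1) ρ hρ1 (hMV p.1 p.2) h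
    nlinarith
  · nlinarith [sq_nonneg (∑ i, ρ i * (if hyp i p.1 ≠ p.2 then (1 : ℝ) else 0))]
end

section
/- C-tandem Oracle Bound: in multiclass classification, if E_ρ[L(h)] < 1/2, then the expected zero-one loss of the ρ-weighted majority vote satisfies L(MV_ρ) ≤ (E_{ρ²}[L(h,h')] − E_ρ[L(h)]²) / (E_{ρ²}[L(h,h')] − E_ρ[L(h)] + 1/4). -/
open MeasureTheory Finset

/-- One-sided Chebyshev (Cantelli) inequality, phrased with the first two moments of `Z`. -/
theorem measureReal_le_cantelli {Ω : Type*} [MeasurableSpace Ω] {P : Measure Ω}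
    [IsProbabilityMeasure P] {Z : Ω → ℝ} (hZ : MemLp Z 2 P) {E : Set Ω} (hE : MeasurableSet E)
    {c : ℝ} (hc : ∫ ω, Z ω ∂P < c) (hEZ : ∀ ω ∈ E, c ≤ Z ω) :
    P.real E ≤ ((∫ ω, Z ω ^ 2 ∂P) - (∫ ω, Z ω ∂P) ^ 2) /
      ((∫ ω, Z ω ^ 2 ∂P) - 2 * c * (∫ ω, Z ω ∂P) + c ^ 2) := by
  have hZ1 : Integrable Z P := hZ.integrable (by norm_num)
  have hZ2 : Integrable (fun ω => Z ω ^ 2) P := hZ.integrable_sq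
  have second_moment : ∀ a b : ℝ, ∫ ω, (a * Z ω + b) ^ 2 ∂P =
      a ^ 2 * (∫ ω, Z ω ^ 2 ∂P) + 2 * a * b * (∫ ω, Z ω ∂P) + b ^ 2 := fun a b => by
    have expand : ∀ ω, (a * Z ω + b) ^ 2 = a ^ 2 * Z ω ^ 2 + 2 * a * b * Z ω + b ^ 2 :=
      fun ω => by ring
    simp_rw [expand]
    have integrable_term : Integrable (fun ω => a ^ 2 * Z ω ^ 2 + 2 * a * b * Z ω) P :=
      (hZ2.const_mul _).add (hZ1.const_mul _)
    rw [integral_add integrable_term (integrable_const _),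
      integral_add (hZ2.const_mul _) (hZ1.const_mul _), integral_const_mul, integral_const_mul]
    simp
  have var_nonneg : 0 ≤ (∫ ω, Z ω ^ 2 ∂P) - (∫ ω, Z ω ∂P) ^ 2 := by
    have h : 0 ≤ ∫ ω, (1 * Z ω + -(∫ ω, Z ω ∂P)) ^ 2 ∂P := integral_nonneg fun ω => sq_nonneg _
    rw [second_moment] at h
    linarith
  have key : ∀ a b : ℝ, 0 ≤ a → 0 ≤ a * c + b → P.real E * (a * c + b) ^ 2 ≤
      a ^ 2 * (∫ ω, Z ω ^ 2 ∂P) + 2 * a * b * (∫ ω, Z ω ∂P) + b ^ 2 := fun a b ha hab => by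
    have integrable_term : Integrable (fun ω => (a * Z ω + b) ^ 2) P :=
      ((hZ.const_mul a).add (memLp_const b)).integrable_sq
    rw [← second_moment, ← smul_eq_mul, ← integral_indicator_const _ hE]
    refine integral_mono ((integrable_const _).indicator hE) integrable_term fun ω => ?_
    refine Set.indicator_apply_le' (fun hω => ?_) (fun _ => sq_nonneg _)
    exact pow_le_pow_left₀ hab
      (add_le_add_left (mul_le_mul_of_nonneg_left (hEZ ω hω) ha) b) 2
  generalize (∫ ω, Z ω ∂P) = m at *
  generalize (∫ ω, Z ω ^ 2 ∂P) = s at *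
  have hpos : 0 < s - 2 * c * m + c ^ 2 := by nlinarith [sq_pos_of_pos (sub_pos.2 hc)]
  have h := key (c - m) (s - m ^ 2 - (c - m) * m) (sub_pos.2 hc).le
    (by nlinarith [sq_nonneg (c - m)])
  rw [le_div_iff₀ hpos]
  refine le_of_mul_le_mul_right ?_ hpos
  linarith

/-- A weighted sum of errors reaches one half wherever a weighted majority vote errs. -/
theorem half_le_sum_of_majority_ne {H Y : Type*} [Fintype H] [DecidableEq Y]
    {ρ : H → ℝ} (hρ0 : ∀ i, 0 ≤ ρ i) (hρ1 : ∑ i, ρ i = 1) {v : H → Y} {m y : Y}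
    (hm : (∑ i, ρ i * (if v i = y then (1:ℝ) else 0)) ≤
      ∑ i, ρ i * (if v i = m then (1:ℝ) else 0)) (hne : m ≠ y) :
    1 / 2 ≤ ∑ i, ρ i * (if v i ≠ y then (1:ℝ) else 0) := by
  have hsum : (∑ i, ρ i * (if v i = y then (1:ℝ) else 0)) +
      ∑ i, ρ i * (if v i ≠ y then (1:ℝ) else 0) = 1 := by
    refine Eq.trans ?_ hρ1
    rw [← Finset.sum_add_distrib]
    refine Finset.sum_congr rfl fun i _ => ?_
    by_cases h : v i = y <;> simp [h]
  have hle : (∑ i, ρ i * (if v i = m then (1:ℝ) else 0)) ≤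
      ∑ i, ρ i * (if v i ≠ y then (1:ℝ) else 0) := by
    refine Finset.sum_le_sum fun i _ => mul_le_mul_of_nonneg_left ?_ (hρ0 i)
    by_cases h : v i = m
    · simp [h, hne]
    · rw [if_neg h]
      positivity
  linarith

/-- C-tandem Oracle Bound: if `E_ρ[L(h)] < 1/2` then
`L(MV_ρ) ≤ (E_{ρ²}[L(h,h')] - E_ρ[L(h)]²) / (E_{ρ²}[L(h,h')] - E_ρ[L(h)] + 1/4)`. -/
theorem c_tandem_oracle_bound
    {X Y H : Type*} [MeasurableSpace X] [MeasurableSpace Y] [MeasurableSingletonClass Y]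
    [Fintype Y] [Nonempty Y] [DecidableEq Y] [Fintype H]
    (D : Measure (X × Y)) [IsProbabilityMeasure D]
    (hyp : H → X → Y) (hmeas : ∀ i, Measurable (hyp i))
    (ρ : H → ℝ) (hρ0 : ∀ i, 0 ≤ ρ i) (hρ1 : ∑ i, ρ i = 1)
    (MV : X → Y) (hMVmeas : Measurable MV)
    (hMV : ∀ x y, (∑ i, ρ i * (if hyp i x = y then (1:ℝ) else 0)) ≤
        ∑ i, ρ i * (if hyp i x = MV x then (1:ℝ) else 0))
    (hL : (∑ i, ρ i * (D {p : X × Y | hyp i p.1 ≠ p.2}).toReal) < 1/2) :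
    (D {p : X × Y | MV p.1 ≠ p.2}).toReal ≤
      ((∑ i, ∑ j, ρ i * ρ j *
          (D {p : X × Y | hyp i p.1 ≠ p.2 ∧ hyp j p.1 ≠ p.2}).toReal) -
        (∑ i, ρ i * (D {p : X × Y | hyp i p.1 ≠ p.2}).toReal)^2) /
      ((∑ i, ∑ j, ρ i * ρ j *
          (D {p : X × Y | hyp i p.1 ≠ p.2 ∧ hyp j p.1 ≠ p.2}).toReal) -
        (∑ i, ρ i * (D {p : X × Y | hyp i p.1 ≠ p.2}).toReal) + 1/4) := by
  have hA : ∀ {f : X → Y}, Measurable f → MeasurableSet {p : X × Y | f p.1 ≠ p.2} := fun hf =>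
    (measurableSet_eq_fun (hf.comp measurable_fst) measurable_snd).compl
  let A : H → Set (X × Y) := fun i => {p | hyp i p.1 ≠ p.2}
  have hAm : ∀ i, MeasurableSet (A i) := fun i => hA (hmeas i)
  let Z : X × Y → ℝ := fun p => ∑ i, ρ i * (A i).indicator 1 p
  have hZ : MemLp Z 2 D := memLp_finsetSum _ fun i _ =>
    ((memLp_const (1:ℝ)).indicator (hAm i)).const_mul (ρ i)
  have mean : ∫ p, Z p ∂D = ∑ i, ρ i * (D (A i)).toReal := by
    have integrable_term : ∀ i, Integrable (fun p => ρ i * (A i).indicator (1 : X × Y → ℝ) p) D := fun i =>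
      ((integrable_const (1:ℝ)).indicator (hAm i)).const_mul _
    rw [integral_finsetSum _ fun i _ => integrable_term i]
    refine Finset.sum_congr rfl fun i _ => ?_
    rw [integral_const_mul, integral_indicator_one (hAm i), measureReal_def]
  have second : ∫ p, Z p ^ 2 ∂D = ∑ i, ∑ j, ρ i * ρ j * (D (A i ∩ A j)).toReal := by
    have expand : ∀ p, Z p ^ 2 = ∑ i, ∑ j, ρ i * ρ j * (A i ∩ A j).indicator 1 p := fun p => by
      simp only [Z, sq, Finset.sum_mul_sum, Set.inter_indicator_one, Pi.mul_apply]
      exact Finset.sum_congr rfl fun i _ => Finset.sum_congr rfl fun j _ => by ring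
    have integrable_term : ∀ i j, Integrable
        (fun p => ρ i * ρ j * (A i ∩ A j).indicator (1 : X × Y → ℝ) p) D := fun i j =>
      ((integrable_const (1:ℝ)).indicator ((hAm i).inter (hAm j))).const_mul _
    simp_rw [expand]
    rw [integral_finsetSum _ fun i _ => integrable_finsetSum _ fun j _ => integrable_term i j]
    refine Finset.sum_congr rfl fun i _ => ?_
    rw [integral_finsetSum _ fun j _ => integrable_term i j]
    refine Finset.sum_congr rfl fun j _ => ?_
    rw [integral_const_mul, integral_indicator_one ((hAm i).inter (hAm j)), measureReal_def]
  have bound := measureReal_le_cantelli hZ (hA hMVmeas) (c := 1 / 2) (mean ▸ hL) fun p hp => by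
    simpa [Z, A, Set.indicator_apply] using
      half_le_sum_of_majority_ne hρ0 hρ1 (hMV p.1 p.2) hp
  rw [mean, second, show (2:ℝ) * (1 / 2) = 1 by norm_num, one_mul,
    show ((1:ℝ) / 2) ^ 2 = 1 / 4 by norm_num] at bound
  exact bound
end

section
/- Refined-Pinsker consequence of a bounded binary KL divergence: for any p̂ ∈ [0,1], p ∈ (0,1), and B ≥ 0, if kl(p̂‖p) ≤ B then p̂ − p ≤ sqrt(2·p̂·B). -/
/-- KL divergence between Bernoulli distributions with biases `p` and `q`,
with the convention `0 · ln 0 = 0`. -/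
noncomputable def klBin (p q : ℝ) : ℝ :=
  (if p = 0 then 0 else p * Real.log (p / q)) +
    (if p = 1 then 0 else (1 - p) * Real.log ((1 - p) / (1 - q)))

theorem add_sq_div_two_le_neg_log_one_sub {t : ℝ} (ht0 : 0 ≤ t) (ht1 : t < 1) :
    t + t ^ 2 / 2 ≤ -Real.log (1 - t) := by
  have h := Real.hasSum_pow_div_log_of_abs_lt_one (x := t) (by rwa [abs_of_nonneg ht0])
  have h2 := sum_le_hasSum (Finset.range 2) (fun i _ => by positivity) h
  norm_num [Finset.sum_range_succ] at h2
  linarith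

theorem sub_add_sq_div_two_mul_le_mul_log_div {a p : ℝ} (hp : 0 < p) (hpa : p ≤ a) :
    (a - p) + (a - p) ^ 2 / (2 * a) ≤ a * Real.log (a / p) := by
  have ha : 0 < a := hp.trans_le hpa
  have h := add_sq_div_two_le_neg_log_one_sub (t := (a - p) / a)
    (div_nonneg (sub_nonneg.2 hpa) ha.le) ((div_lt_one ha).2 (by linarith))
  have hx : 1 - (a - p) / a = (a / p)⁻¹ := by field_simp; ring
  rw [hx, Real.log_inv, neg_neg] at h
  calc (a - p) + (a - p) ^ 2 / (2 * a) = a * ((a - p) / a + ((a - p) / a) ^ 2 / 2) := by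
        field_simp
    _ ≤ a * Real.log (a / p) := mul_le_mul_of_nonneg_left h ha.le

theorem sub_le_mul_log_div {x y : ℝ} (hx : 0 < x) (hy : 0 < y) :
    x - y ≤ x * Real.log (x / y) := by
  have h := mul_le_mul_of_nonneg_left (Real.one_sub_inv_le_log_of_pos (div_pos hx hy)) hx.le
  calc x - y = x * (1 - (x / y)⁻¹) := by field_simp
    _ ≤ x * Real.log (x / y) := h

theorem sq_sub_div_two_mul_le_klBin {a p : ℝ} (ha1 : a ≤ 1) (hp0 : 0 < p) (hp1 : p < 1)
    (hpa : p ≤ a) : (a - p) ^ 2 / (2 * a) ≤ klBin a p := by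
  have h1 := sub_add_sq_div_two_mul_le_mul_log_div hp0 hpa
  rw [klBin, if_neg (hp0.trans_le hpa).ne']
  split_ifs with h
  · linarith
  · have h2 := sub_le_mul_log_div (sub_pos.2 (lt_of_le_of_ne ha1 h)) (sub_pos.2 hp1)
    linarith

/-- Refined-Pinsker consequence of a bounded binary KL divergence:
if `kl(p̂‖p) ≤ B` then `p̂ - p ≤ √(2 p̂ B)`. -/
theorem refined_pinsker_sqrt_bound
    (phat p B : ℝ) (hphat0 : 0 ≤ phat) (hphat1 : phat ≤ 1)
    (hp0 : 0 < p) (hp1 : p < 1) (hB : 0 ≤ B)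
    (hkl : klBin phat p ≤ B) :
    phat - p ≤ Real.sqrt (2 * phat * B) := by
  rcases le_total phat p with h | h
  · exact (sub_nonpos.2 h).trans (Real.sqrt_nonneg _)
  · have hpos : 0 < 2 * phat := by linarith
    have hsq := (sq_sub_div_two_mul_le_klBin hphat1 hp0 hp1 h).trans hkl
    rw [div_le_iff₀' hpos] at hsq
    exact Real.le_sqrt_of_sq_le hsq
end

section
/- PAC-Bayes-λ Inequality: for any prior distribution π on H with π(h) > 0 for all h, and any δ ∈ (0,1), with probability at least 1 − δ over the draw of the i.i.d. sample S of size n from D, the following holds simultaneously for all weightings ρ on H, all λ ∈ (0,2), and all γ > 0: (i) E_ρ[L(h)] ≤ E_ρ[L̂(h,S)]/(1 − λ/2) + (KL(ρ‖π) + ln(2√n/δ))/(λ·(1 − λ/2)·n), and (ii) E_ρ[L(h)] ≥ (1 − γ/2)·E_ρ[L̂(h,S)] − (KL(ρ‖π) + ln(2√n/δ))/(γ·n). -/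
open MeasureTheory Finset

/-- The diagonal case of the Abel binomial identity. -/
theorem sum_choose_mul_pow_mul_sub_pow (n : ℕ) (z : ℝ) :
    ∑ k ∈ range (n + 1), (n.choose k : ℝ) * (k : ℝ) ^ k * (z - k) ^ (n - k) =
      ∑ i ∈ range (n + 1), (n.descFactorial i : ℝ) * z ^ (n - i) := by
  induction n generalizing z with
  | zero => simp
  | succ n ih =>
    have hf (z : ℝ) : HasDerivAt
        (fun z : ℝ => ∑ k ∈ range (n + 1 + 1),
          ((n + 1).choose k : ℝ) * (k : ℝ) ^ k * (z - k) ^ (n + 1 - k))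
        ((n + 1) * ∑ k ∈ range (n + 1), (n.choose k : ℝ) * (k : ℝ) ^ k * (z - k) ^ (n - k)) z := by
      have h := HasDerivAt.fun_sum (u := range (n + 1 + 1)) fun k _ =>
        (((hasDerivAt_id z).sub_const (k : ℝ)).fun_pow (n + 1 - k)).const_mul
          (((n + 1).choose k : ℝ) * (k : ℝ) ^ k)
      refine h.congr_deriv ?_
      rw [sum_range_succ, mul_sum]
      simp only [Nat.sub_self, Nat.cast_zero, zero_mul, mul_zero, add_zero]
      refine sum_congr rfl fun k hk => ?_
      have hk' : k ≤ n := Nat.lt_succ_iff.1 (mem_range.1 hk)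
      have hc : ((n + 1).choose k : ℝ) * ((n + 1 - k : ℕ) : ℝ) = (n + 1) * n.choose k := by
        have := Nat.choose_mul_succ_eq n k
        rw [mul_comm ((n : ℝ) + 1)]
        exact_mod_cast this.symm
      have he : n + 1 - k - 1 = n - k := by omega
      rw [he, mul_one, id]
      linear_combination ((k : ℝ) ^ k * (z - k) ^ (n - k)) * hc
    have hg (z : ℝ) : HasDerivAt
        (fun z : ℝ => ∑ i ∈ range (n + 1 + 1), ((n + 1).descFactorial i : ℝ) * z ^ (n + 1 - i))
        ((n + 1) * ∑ i ∈ range (n + 1), (n.descFactorial i : ℝ) * z ^ (n - i)) z := by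
      have h := HasDerivAt.fun_sum (u := range (n + 1 + 1)) fun i _ =>
        ((hasDerivAt_id z).fun_pow (n + 1 - i)).const_mul ((n + 1).descFactorial i : ℝ)
      refine h.congr_deriv ?_
      rw [sum_range_succ, mul_sum]
      simp only [Nat.sub_self, Nat.cast_zero, zero_mul, mul_zero, add_zero]
      refine sum_congr rfl fun i hi => ?_
      have hc : ((n + 1).descFactorial i : ℝ) * ((n + 1 - i : ℕ) : ℝ) =
          (n + 1) * n.descFactorial i := by
        have h1 := Nat.succ_descFactorial_succ n i
        rw [Nat.descFactorial_succ, mul_comm] at h1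
        exact_mod_cast h1
      have he : n + 1 - i - 1 = n - i := by omega
      rw [he, mul_one, id]
      linear_combination (z ^ (n - i)) * hc
    have hzero : ∑ k ∈ range (n + 1 + 1),
          ((n + 1).choose k : ℝ) * (k : ℝ) ^ k * (0 - (k : ℝ)) ^ (n + 1 - k) =
        ∑ i ∈ range (n + 1 + 1), ((n + 1).descFactorial i : ℝ) * (0 : ℝ) ^ (n + 1 - i) := by
      have h := congrFun (fwdDiff_iter_eq_factorial (R := ℝ) (n := n + 1)) 0
      rw [fwdDiff_iter_eq_sum_shift] at h
      have hr : ∑ i ∈ range (n + 1 + 1), ((n + 1).descFactorial i : ℝ) * (0 : ℝ) ^ (n + 1 - i) =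
          ((n + 1).factorial : ℝ) := by
        rw [sum_range_succ, Nat.descFactorial_self, Nat.sub_self, pow_zero, mul_one,
          add_eq_right]
        refine sum_eq_zero fun i hi => ?_
        have : n + 1 - i ≠ 0 := by have := mem_range.1 hi; omega
        rw [zero_pow this, mul_zero]
      rw [hr]
      refine Eq.trans (sum_congr rfl fun k hk => ?_) h
      have hk' : k ≤ n + 1 := Nat.lt_succ_iff.1 (mem_range.1 hk)
      have hp : (k : ℝ) ^ (n + 1) = (k : ℝ) ^ k * (k : ℝ) ^ (n + 1 - k) := by
        rw [← pow_add, Nat.add_sub_cancel' hk']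
      simp only [zero_sub, zero_add, nsmul_eq_mul, mul_one, zsmul_eq_mul]
      rw [hp, neg_pow]
      push_cast
      ring
    have hd (z : ℝ) := ((hf z).fun_sub (hg z)).congr_deriv
      (show _ = (0 : ℝ) by rw [ih z, sub_self])
    have hconst := is_const_of_deriv_eq_zero (fun z => (hd z).differentiableAt)
      (fun z => (hd z).deriv) z 0
    rw [hzero, sub_self] at hconst
    exact sub_eq_zero.1 hconst

theorem sum_range_max_one_sub_div_le {c : ℝ} (hc : 0 < c) (N : ℕ) :
    ∑ i ∈ range N, max 0 (1 - (i : ℝ) / c) ≤ (2 * c + 1) ^ 2 / (8 * c) := by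
  have hexact (N : ℕ) (hN : (N : ℝ) ≤ c + 1) :
      ∑ i ∈ range N, max 0 (1 - (i : ℝ) / c) = N * (2 * c + 1 - N) / (2 * c) := by
    induction N with
    | zero => simp
    | succ N ih =>
      push_cast at hN
      have h0 : 0 ≤ 1 - (N : ℝ) / c := by
        rw [sub_nonneg, div_le_one hc]; linarith
      rw [sum_range_succ, ih (by linarith), max_eq_right h0]
      push_cast
      field_simp
      ring
  induction N with
  | zero => simp; positivity
  | succ N ih =>
    by_cases hN : (N : ℝ) ≤ c
    · rw [hexact (N + 1) (by push_cast; linarith), div_le_div_iff₀ (by positivity) (by positivity)]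
      push_cast
      nlinarith [mul_nonneg hc.le (sq_nonneg (2 * c + 1 - 2 * ((N : ℝ) + 1)))]
    · have h0 : 1 - (N : ℝ) / c ≤ 0 := by
        rw [sub_nonpos, one_le_div hc]; linarith
      rw [sum_range_succ, max_eq_left h0, add_zero]
      exact ih

theorem sum_descFactorial_div_pow_le {n : ℕ} (hn : 1 ≤ n) :
    ∑ i ∈ range (n + 1), (n.descFactorial i : ℝ) / (n : ℝ) ^ i ≤ 2 * √n := by
  obtain rfl | hn2 : n = 1 ∨ 2 ≤ n := by omega
  · norm_num [sum_range_succ]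
  have hn0 : (0 : ℝ) < n := by positivity
  set t : ℕ → ℝ := fun i => (n.descFactorial i : ℝ) / (n : ℝ) ^ i with ht
  have ht0 (i : ℕ) : 0 ≤ t i := by positivity
  have ht1 (i : ℕ) : t i ≤ 1 := by
    rw [ht, div_le_one (by positivity)]
    exact_mod_cast Nat.descFactorial_le_pow n i
  have htel : ∑ i ∈ range (n + 1), (i : ℝ) * t i = n := by
    have hstep : ∀ i ∈ range (n + 1), (i : ℝ) * t i = n * (t i - t (i + 1)) := by
      intro i hi
      have hi' : i ≤ n := Nat.lt_succ_iff.1 (mem_range.1 hi)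
      simp only [ht, Nat.descFactorial_succ]
      push_cast [Nat.cast_sub hi']
      field_simp
      ring
    rw [sum_congr rfl hstep, ← mul_sum, sum_range_sub']
    simp [ht]
  set c : ℝ := √(2 * n) with hcdef
  have hc2 : c ^ 2 = 2 * n := Real.sq_sqrt (by positivity)
  have hc : 0 < c := Real.sqrt_pos.2 (by positivity)
  have hle : ∑ i ∈ range (n + 1), t i ≤ n / c + (2 * c + 1) ^ 2 / (8 * c) := by
    have hterm : ∀ i ∈ range (n + 1), t i ≤ i * t i / c + max 0 (1 - (i : ℝ) / c) := by
      intro i _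
      have h1 : (1 - (i : ℝ) / c) * t i ≤ max 0 (1 - (i : ℝ) / c) :=
        (mul_le_mul_of_nonneg_right (le_max_right 0 _) (ht0 i)).trans
          (mul_le_of_le_one_right (le_max_left _ _) (ht1 i))
      have h2 : (1 - (i : ℝ) / c) * t i = t i - i * t i / c := by ring
      linarith
    refine (sum_le_sum hterm).trans ?_
    rw [sum_add_distrib, ← sum_div, htel]
    gcongr
    exact sum_range_max_one_sub_div_le hc _
  refine hle.trans ?_
  set s : ℝ := √n with hs
  have hs2 : s ^ 2 = n := Real.sq_sqrt hn0.le
  have hs0 : 0 < s := Real.sqrt_pos.2 hn0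
  have hcge : 2 ≤ c := by
    rw [hcdef]
    apply Real.le_sqrt_of_sq_le
    have : (2 : ℝ) ≤ n := by exact_mod_cast hn2
    linarith
  have hsc : c * 1.41 ≤ 2 * s := by
    apply le_of_sq_le_sq _ (by positivity)
    nlinarith
  have hn' : (n : ℝ) = c ^ 2 / 2 := by linarith
  have : (n : ℝ) / c + (2 * c + 1) ^ 2 / (8 * c) = c + 1 / 2 + 1 / (8 * c) := by
    rw [hn']; field_simp; ring
  rw [this]
  have h8 : 1 / (8 * c) ≤ 1 / 16 := by
    apply one_div_le_one_div_of_le <;> linarith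
  linarith

/-- The normalising sum of the binomial likelihoods at their maximum. -/
theorem sum_choose_mul_div_pow_le {n : ℕ} (hn : 1 ≤ n) :
    ∑ k ∈ range (n + 1),
      (n.choose k : ℝ) * (((k : ℝ) / n) ^ k * (((n - k : ℕ) : ℝ) / n) ^ (n - k)) ≤ 2 * √n := by
  have hn0 : (0 : ℝ) < n := by positivity
  refine le_of_eq_of_le ?_ (sum_descFactorial_div_pow_le hn)
  have h := congrArg (· / (n : ℝ) ^ n) (sum_choose_mul_pow_mul_sub_pow n n)
  simp only [sum_div] at h
  convert h using 2 with k hk i hi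
  · have hk' : k ≤ n := Nat.lt_succ_iff.1 (mem_range.1 hk)
    have hp : (n : ℝ) ^ n = (n : ℝ) ^ k * (n : ℝ) ^ (n - k) := by
      rw [← pow_add, Nat.add_sub_cancel' hk']
    rw [hp, Nat.cast_sub hk', div_pow, div_pow]
    field_simp
  · have hi' : i ≤ n := Nat.lt_succ_iff.1 (mem_range.1 hi)
    have hp : (n : ℝ) ^ n = (n : ℝ) ^ i * (n : ℝ) ^ (n - i) := by
      rw [← pow_add, Nat.add_sub_cancel' hi']
    rw [hp]
    field_simp

theorem pow_le_div_pow_mul_exp {n : ℕ} (hn : 1 ≤ n) (k : ℕ) {u : ℝ} (hu : 0 ≤ u) :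
    u ^ k ≤ ((k : ℝ) / n) ^ k * Real.exp (n * u - k) := by
  have hn0 : (0 : ℝ) < n := by positivity
  obtain rfl | hk := Nat.eq_zero_or_pos k
  · simpa using by positivity
  have hk0 : (0 : ℝ) < k := by positivity
  have h1 : u ≤ (k : ℝ) / n * Real.exp (n * u / k - 1) := by
    have := Real.add_one_le_exp (n * u / k - 1)
    calc u = (k : ℝ) / n * (n * u / k) := by field_simp
      _ ≤ _ := by gcongr; linarith
  calc u ^ k ≤ ((k : ℝ) / n * Real.exp (n * u / k - 1)) ^ k := by gcongr
    _ = _ := by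
      rw [mul_pow, ← Real.exp_nat_mul]
      congr 2
      field_simp

/-- The Gibbs variational bound for the binomial likelihood with success odds tilted by `c`. -/
theorem pow_mul_likelihood_le {n k : ℕ} (hn : 1 ≤ n) (hk : k ≤ n) {p c : ℝ} (hp0 : 0 ≤ p)
    (hp1 : p ≤ 1) (hc : 0 ≤ c) :
    c ^ k * (p ^ k * (1 - p) ^ (n - k)) ≤
      ((k : ℝ) / n) ^ k * (((n - k : ℕ) : ℝ) / n) ^ (n - k) * Real.exp (n * p * (c - 1)) := by
  have h1 := pow_le_div_pow_mul_exp hn k (mul_nonneg hc hp0)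
  have h2 := pow_le_div_pow_mul_exp hn (n - k) (sub_nonneg.2 hp1)
  have h3 := mul_le_mul h1 h2 (pow_nonneg (sub_nonneg.2 hp1) _) (by positivity)
  have he : Real.exp (n * p * (c - 1)) =
      Real.exp (n * (c * p) - k) * Real.exp (n * (1 - p) - (n - k : ℕ)) := by
    rw [← Real.exp_add, Nat.cast_sub hk]
    congr 1
    ring
  rw [he]
  calc _ = (c * p) ^ k * (1 - p) ^ (n - k) := by rw [mul_pow]; ring
    _ ≤ _ := h3
    _ = _ := by ring

theorem exp_upper_deviation_mul_likelihood_le {n k : ℕ} (hn : 1 ≤ n) (hk : k ≤ n)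
    {p l : ℝ} (hp0 : 0 ≤ p)
    (hp1 : p ≤ 1) (hl : 0 ≤ l) :
    Real.exp (n * (l * (1 - l / 2) * p - l * (k / n))) * (p ^ k * (1 - p) ^ (n - k)) ≤
      ((k : ℝ) / n) ^ k * (((n - k : ℕ) : ℝ) / n) ^ (n - k) := by
  have hn0 : (0 : ℝ) < n := by positivity
  have h := pow_mul_likelihood_le hn hk hp0 hp1 (Real.exp_pos (-l)).le
  have hexp : Real.exp (-l) ≤ 1 - l + l ^ 2 / 2 := by
    have h1 := Real.quadratic_le_exp_of_nonneg hl
    rw [Real.exp_neg, inv_le_comm₀ (Real.exp_pos _) (by nlinarith [sq_nonneg (l - 1)])]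
    refine le_trans ?_ h1
    rw [inv_le_iff_one_le_mul₀ (by nlinarith [sq_nonneg (l - 1)])]
    nlinarith [sq_nonneg (l ^ 2)]
  have hle : Real.exp (n * (l * (1 - l / 2) * p - l * (k / n))) ≤
      Real.exp (-l) ^ k * Real.exp (-(n * p * (Real.exp (-l) - 1))) := by
    rw [← Real.exp_nat_mul, ← Real.exp_add]
    apply Real.exp_le_exp.2
    have : n * (l * (1 - l / 2) * p - l * (k / n)) = k * -l + -(n * p * (-l + l ^ 2 / 2)) := by
      field_simp; ring
    rw [this]
    gcongr
    linarith
  calc _ ≤ Real.exp (-l) ^ k * Real.exp (-(n * p * (Real.exp (-l) - 1))) *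
        (p ^ k * (1 - p) ^ (n - k)) :=
        mul_le_mul_of_nonneg_right hle
          (mul_nonneg (pow_nonneg hp0 _) (pow_nonneg (sub_nonneg.2 hp1) _))
    _ = (Real.exp (-l) ^ k * (p ^ k * (1 - p) ^ (n - k))) *
        Real.exp (-(n * p * (Real.exp (-l) - 1))) := by ring
    _ ≤ _ := mul_le_mul_of_nonneg_right h (Real.exp_pos _).le
    _ = _ := by rw [mul_assoc, ← Real.exp_add, add_neg_cancel, Real.exp_zero, mul_one]

theorem exp_lower_deviation_mul_likelihood_le {n k : ℕ} (hn : 1 ≤ n) (hk : k ≤ n)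
    {p g : ℝ} (hp0 : 0 ≤ p)
    (hp1 : p ≤ 1) (hg : 0 ≤ g) :
    Real.exp (n * (g * (1 - g / 2) * (k / n) - g * p)) * (p ^ k * (1 - p) ^ (n - k)) ≤
      ((k : ℝ) / n) ^ k * (((n - k : ℕ) : ℝ) / n) ^ (n - k) := by
  have hn0 : (0 : ℝ) < n := by positivity
  have h := pow_mul_likelihood_le hn hk hp0 hp1 (show 0 ≤ 1 + g by linarith)
  have hexp : Real.exp (g * (1 - g / 2)) ≤ 1 + g := by
    rw [← Real.le_log_iff_exp_le (by linarith)]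
    refine le_trans ?_ (Real.le_log_one_add_of_nonneg hg)
    rw [le_div_iff₀ (by linarith)]
    nlinarith [pow_nonneg hg 3]
  have hle : Real.exp (n * (g * (1 - g / 2) * (k / n) - g * p)) ≤
      (1 + g) ^ k * Real.exp (-(n * p * (1 + g - 1))) := by
    have : n * (g * (1 - g / 2) * (k / n) - g * p) =
        k * (g * (1 - g / 2)) + -(n * p * (1 + g - 1)) := by
      field_simp; ring
    rw [this, Real.exp_add, Real.exp_nat_mul]
    gcongr
  calc _ ≤ (1 + g) ^ k * Real.exp (-(n * p * (1 + g - 1))) * (p ^ k * (1 - p) ^ (n - k)) :=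
        mul_le_mul_of_nonneg_right hle
          (mul_nonneg (pow_nonneg hp0 _) (pow_nonneg (sub_nonneg.2 hp1) _))
    _ = ((1 + g) ^ k * (p ^ k * (1 - p) ^ (n - k))) * Real.exp (-(n * p * (1 + g - 1))) := by ring
    _ ≤ _ := mul_le_mul_of_nonneg_right h (Real.exp_pos _).le
    _ = _ := by rw [mul_assoc, ← Real.exp_add, add_neg_cancel, Real.exp_zero, mul_one]

/-- The Donsker-Varadhan change of measure inequality on a finite set. -/
theorem sum_mul_le_sum_mul_log_div_add_log {ι : Type*} [Fintype ι] {π ρ f : ι → ℝ} {B : ℝ}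
    (hπ : ∀ i, 0 < π i) (hρ0 : ∀ i, 0 ≤ ρ i) (hρ1 : ∑ i, ρ i = 1) (hB : 0 < B)
    (h : ∑ i, π i * Real.exp (f i) ≤ B) :
    ∑ i, ρ i * f i ≤ ∑ i, ρ i * Real.log (ρ i / π i) + Real.log B := by
  have hterm (i : ι) : ρ i * f i - ρ i * Real.log (ρ i / π i) - ρ i * Real.log B ≤
      π i * Real.exp (f i) / B - ρ i := by
    obtain h0 | h0 := (hρ0 i).eq_or_lt
    · rw [← h0]
      have := hπ i
      simp only [zero_mul, sub_zero]
      positivity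
    · have hπi := hπ i
      have h1 := Real.log_le_sub_one_of_pos
        (show 0 < π i * Real.exp (f i) / (ρ i * B) by positivity)
      rw [Real.log_div (by positivity) (by positivity), Real.log_mul (by positivity) (by positivity),
        Real.log_mul (by positivity) (by positivity), Real.log_exp] at h1
      rw [Real.log_div (by positivity) (by positivity)]
      have h2 := mul_le_mul_of_nonneg_left h1 h0.le
      have h3 : ρ i * (π i * Real.exp (f i) / (ρ i * B) - 1) = π i * Real.exp (f i) / B - ρ i := by
        field_simp
      rw [h3] at h2
      linarith
  have hsum := sum_le_sum fun i (_ : i ∈ univ) => hterm i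
  simp only [sum_sub_distrib, ← sum_mul, ← sum_div, hρ1, one_mul] at hsum
  have : (∑ i, π i * Real.exp (f i)) / B ≤ 1 := (div_le_one hB).2 h
  linarith

theorem comp_card_filter_mem_eq_sum_indicator {Ω : Type*} {n : ℕ} (A : Set Ω)
    [DecidablePred (· ∈ A)] (f : ℕ → ENNReal) (S : Fin n → Ω) :
    f #{k | S k ∈ A} = ∑ T : Finset (Fin n),
      (Set.univ.pi fun k => if k ∈ T then A else Aᶜ).indicator (fun _ => f #T) S := by
  have hiff (T : Finset (Fin n)) :
      S ∈ (Set.univ.pi fun k => if k ∈ T then A else Aᶜ) ↔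
        T = ({k | S k ∈ A} : Finset (Fin n)) := by
    simp only [Set.mem_univ_pi, Finset.ext_iff, mem_filter, mem_univ, true_and]
    refine forall_congr' fun k => ?_
    by_cases hk : k ∈ T <;> simp [hk]
  classical
  simp only [Set.indicator_apply, hiff, sum_ite_eq', mem_univ, if_true]

theorem measurableSet_pi_ite_compl {Ω : Type*} [MeasurableSpace Ω] {n : ℕ} {A : Set Ω}
    (hA : MeasurableSet A) (T : Finset (Fin n)) :
    MeasurableSet (Set.univ.pi fun k => if k ∈ T then A else Aᶜ) := by
  refine MeasurableSet.univ_pi fun k => ?_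
  split_ifs
  exacts [hA, hA.compl]

theorem measurable_comp_card_filter_mem {Ω : Type*} [MeasurableSpace Ω] {n : ℕ} {A : Set Ω}
    [DecidablePred (· ∈ A)] (hA : MeasurableSet A)
    (f : ℕ → ENNReal) :
    Measurable fun S : Fin n → Ω => f #{k | S k ∈ A} := by
  simp only [comp_card_filter_mem_eq_sum_indicator]
  exact Finset.measurable_sum _ fun T _ =>
    measurable_const.indicator (measurableSet_pi_ite_compl hA T)

/-- The number of sample points in `A` is binomially distributed. -/
theorem lintegral_comp_card_filter_mem {Ω : Type*} [MeasurableSpace Ω] {n : ℕ} {A : Set Ω}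
    [DecidablePred (· ∈ A)] (μ : Measure Ω) [IsProbabilityMeasure μ] (hA : MeasurableSet A)
    (f : ℕ → ENNReal) :
    ∫⁻ S : Fin n → Ω, f #{k | S k ∈ A} ∂(Measure.pi fun _ => μ) =
      ∑ k ∈ range (n + 1), n.choose k *
        (f k * ENNReal.ofReal ((μ A).toReal ^ k * (1 - (μ A).toReal) ^ (n - k))) := by
  have hp1 : 0 ≤ 1 - (μ A).toReal := sub_nonneg.2 (measureReal_le_one (μ := μ))
  simp only [comp_card_filter_mem_eq_sum_indicator]
  rw [lintegral_finsetSum _ fun T _ =>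
    measurable_const.indicator (measurableSet_pi_ite_compl hA T)]
  have hbox (T : Finset (Fin n)) :
      (Measure.pi fun _ => μ) (Set.univ.pi fun k => if k ∈ T then A else Aᶜ) =
        ENNReal.ofReal ((μ A).toReal ^ #T * (1 - (μ A).toReal) ^ (n - #T)) := by
    have hc : μ Aᶜ = ENNReal.ofReal (1 - (μ A).toReal) := by
      rw [prob_compl_eq_one_sub hA, ENNReal.ofReal_sub _ ENNReal.toReal_nonneg,
        ENNReal.ofReal_one, ENNReal.ofReal_toReal (measure_ne_top _ _)]
    rw [Measure.pi_pi]
    simp only [apply_ite μ]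
    rw [prod_ite, prod_const, prod_const, filter_mem_eq_inter, univ_inter, filter_not,
      filter_mem_eq_inter, univ_inter, card_sdiff_of_subset (subset_univ _), card_univ,
      Fintype.card_fin, ENNReal.ofReal_mul (by positivity), ENNReal.ofReal_pow (by positivity),
      ENNReal.ofReal_pow hp1, ENNReal.ofReal_toReal (measure_ne_top _ _), hc]
  simp only [lintegral_indicator_const (measurableSet_pi_ite_compl hA _), hbox]
  rw [← powerset_univ, sum_powerset_apply_card
    (fun k => f k * ENNReal.ofReal ((μ A).toReal ^ k * (1 - (μ A).toReal) ^ (n - k)))]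
  simp [nsmul_eq_mul]

/-- The likelihood of `k` successes in `n` trials at the empirical frequency `k / n`, relative to
its likelihood at `p`. It is infinite when the latter vanishes. -/
noncomputable def likelihoodRatio (n : ℕ) (p : ℝ) (k : ℕ) : ENNReal :=
  ENNReal.ofReal (((k : ℝ) / n) ^ k * (((n - k : ℕ) : ℝ) / n) ^ (n - k)) /
    ENNReal.ofReal (p ^ k * (1 - p) ^ (n - k))

theorem ofReal_exp_le_likelihoodRatio {n k : ℕ} (hn : 1 ≤ n) {p x : ℝ}
    (h : Real.exp x * (p ^ k * (1 - p) ^ (n - k)) ≤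
      ((k : ℝ) / n) ^ k * (((n - k : ℕ) : ℝ) / n) ^ (n - k)) :
    ENNReal.ofReal (Real.exp x) ≤ likelihoodRatio n p k := by
  have hn0 : (0 : ℝ) < n := by positivity
  have hpos (j : ℕ) : 0 < ((j : ℝ) / n) ^ j := by
    obtain rfl | hj := Nat.eq_zero_or_pos j
    · simp
    · positivity
  rw [likelihoodRatio, ENNReal.le_div_iff_mul_le
    (Or.inr (ENNReal.ofReal_pos.2 (mul_pos (hpos _) (hpos _))).ne') (Or.inl ENNReal.ofReal_ne_top),
    ← ENNReal.ofReal_mul (Real.exp_pos _).le]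
  exact ENNReal.ofReal_le_ofReal h

theorem lintegral_likelihoodRatio_le {Ω : Type*} [MeasurableSpace Ω] {n : ℕ} (hn : 1 ≤ n)
    (μ : Measure Ω) [IsProbabilityMeasure μ] {A : Set Ω} [DecidablePred (· ∈ A)] (hA : MeasurableSet A) :
    ∫⁻ S : Fin n → Ω, likelihoodRatio n (μ A).toReal #{k | S k ∈ A} ∂(Measure.pi fun _ => μ) ≤
      ENNReal.ofReal (2 * √n) := by
  rw [lintegral_comp_card_filter_mem μ hA]
  refine le_trans ?_ (ENNReal.ofReal_le_ofReal (sum_choose_mul_div_pow_le hn))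
  rw [ENNReal.ofReal_sum_of_nonneg fun k _ => by positivity]
  refine sum_le_sum fun k _ => ?_
  rw [ENNReal.ofReal_mul (p := (n.choose k : ℝ)) (by positivity), ENNReal.ofReal_natCast]
  gcongr
  rw [likelihoodRatio, mul_comm]
  exact ENNReal.mul_div_le

/-- PAC-Bayes-λ Inequality: with probability at least `1 - δ` over an i.i.d. sample of
size `n`, simultaneously for all posteriors `ρ`, all `λ ∈ (0,2)` and all `γ > 0`, the
expected loss is upper bounded by the empirical-loss expression with parameter `λ` and
lower bounded by the one with parameter `γ`. -/
theorem pac_bayes_lambda_inequality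
    {X Y H : Type*} [MeasurableSpace X] [MeasurableSpace Y] [MeasurableSingletonClass Y]
    [Fintype Y] [Nonempty Y] [DecidableEq Y] [Fintype H]
    (D : Measure (X × Y)) [IsProbabilityMeasure D]
    (hyp : H → X → Y) (hmeas : ∀ i, Measurable (hyp i))
    (n : ℕ) (hn : 1 ≤ n)
    (π : H → ℝ) (hπ0 : ∀ i, 0 < π i) (hπ1 : ∑ i, π i = 1)
    (δ : ℝ) (hδ0 : 0 < δ) (hδ1 : δ < 1) :
    ENNReal.ofReal (1 - δ) ≤
      (Measure.pi fun _ : Fin n => D)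
        {S : Fin n → X × Y |
          ∀ ρ : H → ℝ, (∀ i, 0 ≤ ρ i) → (∑ i, ρ i) = 1 →
            ∀ l : ℝ, 0 < l → l < 2 → ∀ g : ℝ, 0 < g →
              ((∑ i, ρ i * (D {p : X × Y | hyp i p.1 ≠ p.2}).toReal) ≤
                (∑ i, ρ i * ((n : ℝ)⁻¹ *
                    ∑ k, if hyp i (S k).1 ≠ (S k).2 then (1:ℝ) else 0)) / (1 - l / 2) +
                  ((∑ i, ρ i * Real.log (ρ i / π i)) +
                      Real.log (2 * Real.sqrt n / δ)) / (l * (1 - l / 2) * n)) ∧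
              ((1 - g / 2) * (∑ i, ρ i * ((n : ℝ)⁻¹ *
                    ∑ k, if hyp i (S k).1 ≠ (S k).2 then (1:ℝ) else 0)) -
                  ((∑ i, ρ i * Real.log (ρ i / π i)) +
                      Real.log (2 * Real.sqrt n / δ)) / (g * n) ≤
                ∑ i, ρ i * (D {p : X × Y | hyp i p.1 ≠ p.2}).toReal)} := by
  classical
  have hn0 : (0 : ℝ) < n := by positivity
  set A : H → Set (X × Y) := fun i => {p | hyp i p.1 ≠ p.2} with hAdef
  have hA (i : H) : MeasurableSet (A i) :=
    (measurableSet_eq_fun ((hmeas i).comp measurable_fst) measurable_snd).compl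
  set B : ℝ := 2 * √n / δ with hB
  have hB0 : 0 < B := by positivity
  set F : (Fin n → X × Y) → ENNReal := fun S =>
    ∑ i, ENNReal.ofReal (π i) * likelihoodRatio n (D (A i)).toReal #{k | S k ∈ A i} with hF
  have hFm : Measurable F := Finset.measurable_sum _ fun i _ =>
    (measurable_comp_card_filter_mem (hA i) (likelihoodRatio n (D (A i)).toReal)).const_mul _
  have hFint : ∫⁻ S, F S ∂(Measure.pi fun _ => D) ≤ ENNReal.ofReal (2 * √n) := by
    rw [lintegral_finsetSum _ fun i _ =>
      (measurable_comp_card_filter_mem (hA i) (likelihoodRatio n (D (A i)).toReal)).const_mul _]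
    calc _ ≤ ∑ i, ENNReal.ofReal (π i) * ENNReal.ofReal (2 * √n) := by
          refine sum_le_sum fun i _ => ?_
          rw [lintegral_const_mul _ (measurable_comp_card_filter_mem (hA i) _)]
          gcongr
          exact lintegral_likelihoodRatio_le hn D (hA i)
      _ = _ := by
          rw [← sum_mul, ← ENNReal.ofReal_sum_of_nonneg fun i _ => (hπ0 i).le, hπ1,
            ENNReal.ofReal_one, one_mul]
  have hmarkov : (Measure.pi fun _ : Fin n => D) {S | ENNReal.ofReal B ≤ F S} ≤
      ENNReal.ofReal δ := by
    refine (meas_ge_le_lintegral_div hFm.aemeasurable (ENNReal.ofReal_pos.2 hB0).ne'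
      ENNReal.ofReal_ne_top).trans ?_
    refine ENNReal.div_le_of_le_mul (hFint.trans ?_)
    rw [← ENNReal.ofReal_mul hδ0.le, hB, mul_div_cancel₀ _ hδ0.ne']
  have hgood : ENNReal.ofReal (1 - δ) ≤
      (Measure.pi fun _ : Fin n => D) {S | ENNReal.ofReal B ≤ F S}ᶜ := by
    rw [prob_compl_eq_one_sub (measurableSet_le measurable_const hFm),
      ENNReal.ofReal_sub _ hδ0.le, ENNReal.ofReal_one]
    exact tsub_le_tsub_left hmarkov _
  refine hgood.trans (measure_mono fun S hS => ?_)
  replace hS : F S < ENNReal.ofReal B := not_le.1 fun h => hS h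
  intro ρ hρ0 hρ1 l hl0 hl2 g hg0
  have hp0 (i : H) : 0 ≤ (D (A i)).toReal := ENNReal.toReal_nonneg
  have hp1 (i : H) : (D (A i)).toReal ≤ 1 := measureReal_le_one (μ := D)
  have hcard (i : H) : #{k | S k ∈ A i} ≤ n := by
    simpa using card_le_univ (α := Fin n) {k | S k ∈ A i}
  have hemp (i : H) : (n : ℝ)⁻¹ * ∑ k, (if hyp i (S k).1 ≠ (S k).2 then (1 : ℝ) else 0) =
      (#{k | S k ∈ A i} : ℝ) / n := by
    rw [sum_boole, div_eq_inv_mul]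
    simp only [hAdef, Set.mem_ofPred_eq]
  have hchange (f : H → ℝ) (hf : ∀ i, ENNReal.ofReal (Real.exp (n * f i)) ≤
      likelihoodRatio n (D (A i)).toReal #{k | S k ∈ A i}) :
      n * ∑ i, ρ i * f i ≤ ∑ i, ρ i * Real.log (ρ i / π i) + Real.log B := by
    have hsum : ∑ i, π i * Real.exp (n * f i) ≤ B := by
      rw [← ENNReal.ofReal_le_ofReal_iff hB0.le,
        ENNReal.ofReal_sum_of_nonneg fun i _ => mul_nonneg (hπ0 i).le (Real.exp_pos _).le]
      refine le_trans (sum_le_sum fun i _ => ?_) hS.le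
      rw [ENNReal.ofReal_mul (hπ0 i).le]
      gcongr
      exact hf i
    refine le_of_eq_of_le ?_ (sum_mul_le_sum_mul_log_div_add_log hπ0 hρ0 hρ1 hB0 hsum)
    rw [mul_sum]
    exact sum_congr rfl fun i _ => by ring
  simp only [hemp]
  have hupper := hchange _ fun i => ofReal_exp_le_likelihoodRatio hn
    (exp_upper_deviation_mul_likelihood_le hn (hcard i) (hp0 i) (hp1 i) hl0.le)
  have hlower := hchange _ fun i => ofReal_exp_le_likelihoodRatio hn
    (exp_lower_deviation_mul_likelihood_le hn (hcard i) (hp0 i) (hp1 i) hg0.le)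
  simp only [mul_sub, sum_sub_distrib, mul_left_comm (ρ _), ← mul_sum] at hupper hlower
  generalize (∑ i, ρ i * Real.log (ρ i / π i)) + Real.log B = K at hupper hlower ⊢
  generalize (∑ i, ρ i * (D (A i)).toReal) = P at hupper hlower ⊢
  generalize (∑ i, ρ i * ((#{k | S k ∈ A i} : ℝ) / n)) = Q at hupper hlower ⊢
  constructor
  · have hl : 0 < 1 - l / 2 := by linarith
    have : Q / (1 - l / 2) + K / (l * (1 - l / 2) * n) = (n * (l * Q) + K) / (l * (1 - l / 2) * n) := by
      field_simp
    rw [this, le_div_iff₀ (by positivity)]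
    linarith
  · rw [sub_le_iff_le_add, ← sub_le_iff_le_add', le_div_iff₀ (by positivity)]
    linarith
end

section
/- PAC-Bayesian second order (tandem) bound: for any prior distribution π on H with π(h) > 0 for all h, and any δ ∈ (0,1), with probability at least 1 − δ over the draw of the i.i.d. sample S of size n from D, the following holds simultaneously for all weightings ρ on H and all λ ∈ (0,2): L(MV_ρ) ≤ 4·( E_{ρ²}[L̂(h,h',S)]/(1 − λ/2) + (2·KL(ρ‖π) + ln(2√n/δ))/(λ·(1 − λ/2)·n) ). -/
open MeasureTheory Finset

lemma pow_mul_pow_le_max_likelihood {n k : ℕ} (hk : k ≤ n) {x y : ℝ} (hx : 0 ≤ x) (hy : 0 ≤ y) :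
    x ^ k * y ^ (n - k) ≤
      ((k : ℝ) / n) ^ k * (1 - (k : ℝ) / n) ^ (n - k) * (x + y) ^ n := by
  rcases Nat.eq_zero_or_pos k with rfl | hk0
  · simpa using pow_le_pow_left₀ hy (by linarith) n
  rcases hk.eq_or_lt with rfl | hkn
  · have : (k : ℝ) ≠ 0 := by positivity
    simpa [this] using pow_le_pow_left₀ hx (by linarith) k
  have hn : (0 : ℝ) < n := by exact_mod_cast hk0.trans hkn
  have hkR : (0 : ℝ) < k := by exact_mod_cast hk0
  have hknR : (k : ℝ) < n := by exact_mod_cast hkn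
  set q : ℝ := (k : ℝ) / n with hq
  have hq0 : 0 < q := by positivity
  have hq1 : 0 < 1 - q := by
    rw [hq, sub_pos, div_lt_one hn]; exact hknR
  have hX : 0 ≤ x / q := by positivity
  have hY : 0 ≤ y / (1 - q) := by positivity
  have key := Real.geom_mean_le_arith_mean2_weighted hq0.le hq1.le hX hY (by ring)
  rw [mul_div_cancel₀ _ hq0.ne', mul_div_cancel₀ _ hq1.ne'] at key
  have key' := pow_le_pow_left₀ (by positivity) key n
  have e1 : q * (n : ℝ) = k := by rw [hq]; field_simp
  have e2 : (1 - q) * (n : ℝ) = ((n - k : ℕ) : ℝ) := by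
    rw [Nat.cast_sub hk, sub_mul, e1, one_mul]
  rw [mul_pow, ← Real.rpow_natCast ((x / q) ^ q), ← Real.rpow_mul hX,
    ← Real.rpow_natCast ((y / (1 - q)) ^ (1 - q)), ← Real.rpow_mul hY, e1, e2,
    Real.rpow_natCast, Real.rpow_natCast, div_pow x q, div_pow y (1 - q), div_mul_div_comm,
    div_le_iff₀ (by positivity)] at key'
  linarith

lemma exp_neg_le_quadratic {u : ℝ} (hu : 0 ≤ u) : Real.exp (-u) ≤ 1 - u + u ^ 2 / 2 := by
  have h := Real.quadratic_le_exp_of_nonneg hu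
  rw [Real.exp_neg, inv_le_iff_one_le_mul₀ (Real.exp_pos u)]
  have h2 : 0 ≤ 1 - u + u ^ 2 / 2 := by nlinarith [sq_nonneg (u - 1)]
  nlinarith [mul_le_mul_of_nonneg_left h h2, sq_nonneg (u ^ 2)]

/-- A refined Pinsker inequality between Bernoulli parameters, in likelihood-ratio form. -/
lemma bernoulli_weight_mul_exp_le {n k : ℕ} (hn : 1 ≤ n) (hk : k ≤ n) {p u : ℝ}
    (hp0 : 0 ≤ p) (hp1 : p ≤ 1) (hu : u = max 0 (p - (k : ℝ) / n) / p) :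
    p ^ k * (1 - p) ^ (n - k) * Real.exp (n * (p * u ^ 2 / 2)) ≤
      ((k : ℝ) / n) ^ k * (1 - (k : ℝ) / n) ^ (n - k) := by
  have hnR : (0 : ℝ) < n := by exact_mod_cast hn
  have hu0 : 0 ≤ u := by rw [hu]; positivity
  set q : ℝ := (k : ℝ) / n with hq
  have hq0 : 0 ≤ q := by positivity
  have hq1 : q ≤ 1 := by rw [hq, div_le_one hnR]; exact_mod_cast hk
  have hpu : p * u = max 0 (p - q) := by
    rcases hp0.eq_or_lt with rfl | hp
    · simp [hq0]
    · rw [hu]; field_simp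
  have hqu : q * u ≤ p * u - p * u ^ 2 := by
    rcases max_cases 0 (p - q) with ⟨h, h'⟩ | ⟨h, h'⟩
    · have : u = 0 := by rw [hu, h, zero_div]
      simp [this]
    · rw [h] at hpu
      nlinarith
  have h1 := pow_mul_pow_le_max_likelihood hk (mul_nonneg hp0 (Real.exp_pos (-u)).le)
    (sub_nonneg.2 hp1)
  have h2 : p * Real.exp (-u) + (1 - p) ≤ Real.exp (-(p * u) + p * u ^ 2 / 2) := by
    have := Real.add_one_le_exp (-(p * u) + p * u ^ 2 / 2)
    have := mul_le_mul_of_nonneg_left (exp_neg_le_quadratic hu0) hp0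
    linarith
  have h3 : 0 ≤ p * Real.exp (-u) + (1 - p) := by
    have := mul_nonneg hp0 (Real.exp_pos (-u)).le
    linarith
  have h4 := pow_le_pow_left₀ h3 h2 n
  have hQ : 0 ≤ q ^ k * (1 - q) ^ (n - k) :=
    mul_nonneg (pow_nonneg hq0 _) (pow_nonneg (sub_nonneg.2 hq1) _)
  have h5 := h1.trans (mul_le_mul_of_nonneg_left h4 hQ)
  rw [mul_pow, ← Real.exp_nat_mul, ← Real.exp_nat_mul] at h5
  have e1 : (k : ℝ) = q * n := by rw [hq]; field_simp
  have h6 : Real.exp (n * (p * u ^ 2 / 2)) ≤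
      Real.exp (k * -u) * Real.exp (-(n * (-(p * u) + p * u ^ 2 / 2))) := by
    rw [← Real.exp_add, Real.exp_le_exp, e1]
    nlinarith
  have hP : 0 ≤ p ^ k * (1 - p) ^ (n - k) :=
    mul_nonneg (pow_nonneg hp0 _) (pow_nonneg (sub_nonneg.2 hp1) _)
  calc _ ≤ p ^ k * (1 - p) ^ (n - k) *
        (Real.exp (k * -u) * Real.exp (-(n * (-(p * u) + p * u ^ 2 / 2)))) :=
        mul_le_mul_of_nonneg_left h6 hP
    _ = (p ^ k * Real.exp (k * -u) * (1 - p) ^ (n - k)) *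
        Real.exp (-(n * (-(p * u) + p * u ^ 2 / 2))) := by ring
    _ ≤ (q ^ k * (1 - q) ^ (n - k) * Real.exp (n * (-(p * u) + p * u ^ 2 / 2))) *
        Real.exp (-(n * (-(p * u) + p * u ^ 2 / 2))) :=
        mul_le_mul_of_nonneg_right h5 (Real.exp_pos _).le
    _ = _ := by rw [mul_assoc, ← Real.exp_add, add_neg_cancel, Real.exp_zero, mul_one]

lemma donsker_varadhan {ι : Type*} [Fintype ι] {r w g : ι → ℝ} (hr : ∀ a, 0 ≤ r a)
    (hr1 : ∑ a, r a = 1) (hw : ∀ a, 0 < w a) {C : ℝ} (hC : 0 < C)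
    (hle : ∑ a, w a * Real.exp (g a) ≤ C) :
    ∑ a, r a * g a ≤ ∑ a, r a * Real.log (r a / w a) + Real.log C := by
  have key : ∀ a, r a * g a - r a * Real.log (r a / w a) - r a * Real.log C ≤
      w a * Real.exp (g a) / C - r a := by
    intro a
    rcases (hr a).eq_or_lt with h | h
    · rw [← h]
      have := hw a
      simp only [zero_mul, sub_zero]
      positivity
    · have hwa := hw a
      have h1 := Real.log_le_sub_one_of_pos
        (show 0 < w a * Real.exp (g a) / (C * r a) by positivity)
      rw [Real.log_div (by positivity) (by positivity), Real.log_mul hwa.ne' (by positivity),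
        Real.log_exp, Real.log_mul hC.ne' h.ne'] at h1
      rw [Real.log_div h.ne' hwa.ne']
      have h2 := mul_le_mul_of_nonneg_left h1 h.le
      have h3 : r a * (w a * Real.exp (g a) / (C * r a) - 1) =
          w a * Real.exp (g a) / C - r a := by field_simp
      linarith
  have hsum := sum_le_sum fun a (_ : a ∈ univ) => key a
  simp only [sum_sub_distrib, ← sum_mul, ← sum_div, hr1] at hsum
  have : (∑ a, w a * Real.exp (g a)) / C ≤ 1 := (div_le_one hC).2 hle
  linarith

lemma sum_mul_mul_log_div {H : Type*} [Fintype H] {ρ π : H → ℝ} (hρ1 : ∑ i, ρ i = 1)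
    (hπ : ∀ i, 0 < π i) :
    ∑ a : H × H, ρ a.1 * ρ a.2 * Real.log (ρ a.1 * ρ a.2 / (π a.1 * π a.2)) =
      2 * ∑ i, ρ i * Real.log (ρ i / π i) := by
  have h : ∀ i j, ρ i * ρ j * Real.log (ρ i * ρ j / (π i * π j)) =
      ρ j * (ρ i * Real.log (ρ i / π i)) + ρ i * (ρ j * Real.log (ρ j / π j)) := by
    intro i j
    by_cases hi : ρ i = 0
    · simp [hi]
    by_cases hj : ρ j = 0
    · simp [hj]
    rw [mul_div_mul_comm, Real.log_mul (div_ne_zero hi (hπ i).ne') (div_ne_zero hj (hπ j).ne')]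
    ring
  rw [Fintype.sum_prod_type]
  simp only [h, sum_add_distrib, ← sum_mul, ← mul_sum, hρ1]
  ring

lemma lintegral_card_filter_mem {Z : Type*} [MeasurableSpace Z] (D : Measure Z)
    [IsProbabilityMeasure D] {A : Set Z} [DecidablePred (· ∈ A)] (hA : MeasurableSet A) (n : ℕ)
    {f : ℕ → ℝ} (hf : ∀ k, 0 ≤ f k) :
    ∫⁻ S, ENNReal.ofReal (f #{k | S k ∈ A}) ∂(Measure.pi fun _ : Fin n => D) =
      ENNReal.ofReal (∑ k ∈ range (n + 1),
        n.choose k * (D.real A ^ k * (1 - D.real A) ^ (n - k) * f k)) := by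
  set W : (Fin n → Z) → Finset (Fin n) := fun S => ({k | S k ∈ A} : Finset (Fin n)) with hW
  let _ : MeasurableSpace (Finset (Fin n)) := ⊤
  have hpre : ∀ T : Finset (Fin n),
      W ⁻¹' {T} = Set.univ.pi fun k => if k ∈ T then A else Aᶜ := by
    intro T
    ext S
    simp only [hW, Set.mem_preimage, Set.mem_singleton_iff, Finset.ext_iff, mem_filter,
      mem_univ, true_and, Set.mem_univ_pi]
    refine forall_congr' fun k => ?_
    by_cases hk : k ∈ T <;> simp [hk]
  have hWm : Measurable W := by
    refine measurable_to_countable' fun T => ?_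
    rw [hpre]
    refine MeasurableSet.univ_pi fun k => ?_
    split_ifs
    exacts [hA, hA.compl]
  have hp : 0 ≤ 1 - D.real A := sub_nonneg.2 measureReal_le_one
  have hmass : ∀ T : Finset (Fin n), (Measure.pi fun _ : Fin n => D) (W ⁻¹' {T}) =
      ENNReal.ofReal (D.real A ^ #T * (1 - D.real A) ^ (n - #T)) := by
    intro T
    rw [hpre, Measure.pi_pi, ENNReal.ofReal_mul (by positivity), ENNReal.ofReal_pow (by positivity),
      ENNReal.ofReal_pow hp, ← probReal_compl_eq_one_sub hA, ofReal_measureReal, ofReal_measureReal]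
    simp only [apply_ite D, prod_ite, prod_const]
    congr 2
    · simp
    · rw [filter_not]; simp [card_sdiff]
  calc _ = ∫⁻ T, ENNReal.ofReal (f #T) ∂((Measure.pi fun _ : Fin n => D).map W) :=
        (lintegral_map (f := fun T => ENNReal.ofReal (f #T)) (measurable_from_top) hWm).symm
    _ = ∑ T : Finset (Fin n), ENNReal.ofReal (D.real A ^ #T * (1 - D.real A) ^ (n - #T) * f #T) := by
        rw [lintegral_fintype]
        refine sum_congr rfl fun T _ => ?_
        rw [Measure.map_apply hWm (MeasurableSpace.measurableSet_top), hmass, mul_comm,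
          ← ENNReal.ofReal_mul (by positivity)]
    _ = _ := by
        rw [← ENNReal.ofReal_sum_of_nonneg (fun T _ => mul_nonneg (by positivity) (hf _)),
          ← powerset_univ,
          sum_powerset_apply_card (fun k => D.real A ^ k * (1 - D.real A) ^ (n - k) * f k)]
        simp

lemma factorial_le_exp_mul_sqrt {n : ℕ} (hn : n ≠ 0) :
    (n.factorial : ℝ) ≤ Real.exp 1 * √n * (n / Real.exp 1) ^ n := by
  obtain ⟨m, rfl⟩ := Nat.exists_eq_succ_of_ne_zero hn
  have h := Stirling.stirlingSeq'_antitone (Nat.zero_le m)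
  simp only [Function.comp, Nat.succ_eq_add_one, zero_add, Stirling.stirlingSeq_one] at h
  rw [Stirling.stirlingSeq, div_le_iff₀ (by positivity), Real.sqrt_mul (by norm_num)] at h
  refine h.trans_eq ?_
  have : √(2 : ℝ) ≠ 0 := by positivity
  field_simp

lemma sum_inv_sqrt_le {m : ℕ} (hm : 1 ≤ m) :
    ∑ k ∈ range m, (√((k + 1 : ℕ) : ℝ))⁻¹ ≤ 2 * √m - 1 := by
  induction m, hm using Nat.le_induction with
  | base => norm_num
  | succ m hm ih =>
    rw [sum_range_succ]
    have h0 : 0 < √((m + 1 : ℕ) : ℝ) := by positivity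
    have h1 := Real.sq_sqrt (show (0 : ℝ) ≤ ((m + 1 : ℕ) : ℝ) by positivity)
    have h2 := Real.sq_sqrt (show (0 : ℝ) ≤ (m : ℝ) by positivity)
    push_cast at h0 h1 ih ⊢
    have h3 : (√((m : ℝ) + 1))⁻¹ ≤ 2 * (√((m : ℝ) + 1) - √m) := by
      rw [inv_le_iff_one_le_mul₀ h0]
      nlinarith [sq_nonneg (√((m : ℝ) + 1) - √m)]
    linarith

lemma choose_mul_pow_mul_pow_le {k l : ℕ} (hk : k ≠ 0) (hl : l ≠ 0) :
    ((k + l).choose k : ℝ) *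
        (((k : ℝ) / (k + l : ℕ)) ^ k * (1 - (k : ℝ) / (k + l : ℕ)) ^ l) ≤
      Real.exp 1 / (2 * Real.pi) * ((√k)⁻¹ + (√l)⁻¹) := by
  have hkR : (0 : ℝ) < k := by positivity
  have hlR : (0 : ℝ) < l := by positivity
  have hn : k + l ≠ 0 := by omega
  have e1 : 1 - (k : ℝ) / (k + l : ℕ) = l / (k + l : ℕ) := by push_cast; field_simp; ring
  rw [e1, Nat.cast_add_choose]
  have hN := factorial_le_exp_mul_sqrt hn
  have hK := Stirling.le_factorial_stirling k
  have hL := Stirling.le_factorial_stirling l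
  have hs : √((k + l : ℕ) : ℝ) ≤ √k + √l := by
    rw [Real.sqrt_le_left (by positivity)]
    push_cast
    nlinarith [Real.sq_sqrt hkR.le, Real.sq_sqrt hlR.le, Real.sqrt_nonneg k, Real.sqrt_nonneg l,
      mul_nonneg (Real.sqrt_nonneg k) (Real.sqrt_nonneg l)]
  set N : ℝ := ((k + l : ℕ) : ℝ) with hNdef
  have hNpos : 0 < N := by positivity
  have hKL := mul_le_mul hK hL (by positivity) (by positivity)
  have hpi : √(2 * Real.pi * k) * √(2 * Real.pi * l) = 2 * Real.pi * (√k * √l) := by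
    rw [Real.sqrt_mul (by positivity) (k : ℝ), Real.sqrt_mul (by positivity) (l : ℝ)]
    linear_combination (√k * √l) * Real.mul_self_sqrt (show 0 ≤ 2 * Real.pi by positivity)
  calc _ ≤ Real.exp 1 * √N * (N / Real.exp 1) ^ (k + l) /
        (√(2 * Real.pi * k) * (k / Real.exp 1) ^ k * (√(2 * Real.pi * l) * (l / Real.exp 1) ^ l)) *
        ((k / N) ^ k * (l / N) ^ l) := by gcongr
    _ = Real.exp 1 * √N / (√(2 * Real.pi * k) * √(2 * Real.pi * l)) := by
        simp only [pow_add, div_pow]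
        field_simp
    _ = Real.exp 1 / (2 * Real.pi) * (√N / (√k * √l)) := by
        rw [hpi]; field_simp
    _ ≤ Real.exp 1 / (2 * Real.pi) * ((√k + √l) / (√k * √l)) := by gcongr
    _ = _ := by field_simp; ring

/-- Maurer's bound on the sum of the maximal binomial likelihoods. -/
lemma sum_choose_mul_pow_mul_pow_le {n : ℕ} (hn : 1 ≤ n) :
    ∑ k ∈ range (n + 1), (n.choose k : ℝ) *
      (((k : ℝ) / n) ^ k * (1 - (k : ℝ) / n) ^ (n - k)) ≤ 2 * √n := by
  rcases lt_or_ge n 18 with hlt | hge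
  · suffices h : ∑ k ∈ range (n + 1), (n.choose k : ℝ) *
        (((k : ℝ) / n) ^ k * (1 - (k : ℝ) / n) ^ (n - k)) ≤ √(4 * n) by
      rwa [Real.sqrt_mul (by norm_num), show √(4 : ℝ) = 2 by
        rw [show (4 : ℝ) = 2 ^ 2 by norm_num]; simp] at h
    apply Real.le_sqrt_of_sq_le
    interval_cases n <;> norm_num [sum_range_succ, Nat.choose]
  obtain ⟨m, rfl⟩ : ∃ m, n = m + 1 := ⟨n - 1, by omega⟩
  have hterm : ∀ k ∈ range m, ((m + 1).choose (k + 1) : ℝ) *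
      ((((k + 1 : ℕ) : ℝ) / (m + 1 : ℕ)) ^ (k + 1) *
        (1 - ((k + 1 : ℕ) : ℝ) / (m + 1 : ℕ)) ^ (m + 1 - (k + 1))) ≤
      Real.exp 1 / (2 * Real.pi) *
        ((√((k + 1 : ℕ) : ℝ))⁻¹ + (√((m - 1 - k + 1 : ℕ) : ℝ))⁻¹) := by
    intro k hk
    rw [mem_range] at hk
    have h := choose_mul_pow_mul_pow_le (k := k + 1) (l := m - 1 - k + 1) (by omega) (by omega)
    rw [show k + 1 + (m - 1 - k + 1) = m + 1 by omega] at h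
    rwa [show m + 1 - (k + 1) = m - 1 - k + 1 by omega]
  have hm : 1 ≤ m := by omega
  have hsum := sum_le_sum hterm
  rw [← mul_sum, sum_add_distrib,
    sum_range_reflect (fun k => (√((k + 1 : ℕ) : ℝ))⁻¹) m] at hsum
  have hinv := sum_inv_sqrt_le hm
  have hmn : √(m : ℝ) ≤ √((m + 1 : ℕ) : ℝ) := Real.sqrt_le_sqrt (by simp)
  have hc : Real.exp 1 / (2 * Real.pi) ≤ 0.433 := by
    rw [div_le_iff₀ (by positivity)]
    linarith [Real.exp_one_lt_d9, Real.pi_gt_d2]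
  have hc0 : 0 ≤ Real.exp 1 / (2 * Real.pi) := by positivity
  have hbig : (4.24 : ℝ) ≤ √((m + 1 : ℕ) : ℝ) := by
    apply Real.le_sqrt_of_sq_le
    have : (18 : ℝ) ≤ ((m + 1 : ℕ) : ℝ) := by exact_mod_cast hge
    linarith
  rw [sum_range_succ, sum_range_succ']
  have hlast : ((m + 1 : ℕ) : ℝ) / ((m + 1 : ℕ) : ℝ) = 1 := div_self (by positivity)
  rw [hlast]
  simp only [Nat.choose_zero_right, Nat.choose_self, Nat.cast_zero, Nat.cast_one, zero_div,
    sub_zero, one_pow, pow_zero, Nat.sub_self, mul_one]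
  have hfin : Real.exp 1 / (2 * Real.pi) *
      (∑ k ∈ range m, (√((k + 1 : ℕ) : ℝ))⁻¹ + ∑ k ∈ range m, (√((k + 1 : ℕ) : ℝ))⁻¹) ≤
      0.433 * (4 * √((m + 1 : ℕ) : ℝ) - 2) := by
    refine mul_le_mul hc (by linarith) (by positivity) (by norm_num)
  linarith

/-- The exponential of `n` times the one-sided deviation `(p - k / n)₊ ^ 2 / (2 * p)`. -/
noncomputable def expDeviation (n : ℕ) (p : ℝ) (k : ℕ) : ℝ :=
  Real.exp (n * (p * (max 0 (p - (k : ℝ) / n) / p) ^ 2 / 2))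

lemma expDeviation_nonneg (n : ℕ) (p : ℝ) (k : ℕ) : 0 ≤ expDeviation n p k :=
  (Real.exp_pos _).le

lemma exp_linear_le_expDeviation (n k : ℕ) {p : ℝ} (hp : 0 ≤ p) {l : ℝ} (hl : 0 ≤ l) :
    Real.exp (n * (l * (p - (k : ℝ) / n) - l ^ 2 * p / 2)) ≤ expDeviation n p k := by
  have hq : (0 : ℝ) ≤ (k : ℝ) / n := by positivity
  rw [expDeviation, Real.exp_le_exp]
  refine mul_le_mul_of_nonneg_left ?_ n.cast_nonneg
  rcases hp.eq_or_lt with rfl | hp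
  · simpa using mul_nonneg hl hq
  set u := max 0 (p - (k : ℝ) / n) / p with hu
  have hpu : p * u = max 0 (p - (k : ℝ) / n) := by rw [hu]; field_simp
  have h1 : l * (p - (k : ℝ) / n) ≤ l * (p * u) := by
    rw [hpu]
    exact mul_le_mul_of_nonneg_left (le_max_right _ _) hl
  nlinarith [mul_nonneg hp.le (sq_nonneg (l - u))]

lemma lintegral_expDeviation_le {Z : Type*} [MeasurableSpace Z] (D : Measure Z)
    [IsProbabilityMeasure D] {A : Set Z} [DecidablePred (· ∈ A)] (hA : MeasurableSet A) {n : ℕ}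
    (hn : 1 ≤ n) :
    ∫⁻ S, ENNReal.ofReal (expDeviation n (D.real A) #{k | S k ∈ A})
      ∂(Measure.pi fun _ : Fin n => D) ≤ ENNReal.ofReal (2 * √n) := by
  rw [lintegral_card_filter_mem D hA n (expDeviation_nonneg n _)]
  refine ENNReal.ofReal_le_ofReal (le_trans (sum_le_sum fun k hk => ?_)
    (sum_choose_mul_pow_mul_pow_le hn))
  exact mul_le_mul_of_nonneg_left (bernoulli_weight_mul_exp_le hn
    (Nat.lt_succ_iff.1 (mem_range.1 hk)) measureReal_nonneg measureReal_le_one rfl)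
    (Nat.cast_nonneg _)

lemma measurable_card_filter_mem {Z : Type*} [MeasurableSpace Z] {A : Set Z}
    [DecidablePred (· ∈ A)] (hA : MeasurableSet A) (n : ℕ) :
    Measurable fun S : Fin n → Z => #{k | S k ∈ A} := by
  simp only [card_filter]
  exact Finset.measurable_fun_sum _ fun k _ =>
    Measurable.ite (measurable_pi_apply k hA) measurable_const measurable_const

lemma le_measure_expDeviation_lt {Z ι : Type*} [MeasurableSpace Z] [Fintype ι] (D : Measure Z)
    [IsProbabilityMeasure D] {A : ι → Set Z} [∀ a, DecidablePred (· ∈ A a)]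
    (hA : ∀ a, MeasurableSet (A a)) {n : ℕ} (hn : 1 ≤ n) {w : ι → ℝ} (hw : ∀ a, 0 ≤ w a)
    (hw1 : ∑ a, w a = 1) {δ : ℝ} (hδ : 0 < δ) :
    ENNReal.ofReal (1 - δ) ≤ (Measure.pi fun _ : Fin n => D)
      {S | ∑ a, w a * expDeviation n (D.real (A a)) #{k | S k ∈ A a} < 2 * √n / δ} := by
  set μ := Measure.pi fun _ : Fin n => D
  set G : (Fin n → Z) → ℝ := fun S => ∑ a, w a * expDeviation n (D.real (A a)) #{k | S k ∈ A a}
  have hF : ∀ a, Measurable fun S : Fin n → Z =>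
      expDeviation n (D.real (A a)) #{k | S k ∈ A a} := fun a =>
    (measurable_from_top (f := expDeviation n (D.real (A a)))).comp
      (measurable_card_filter_mem (hA a) n)
  have hG : Measurable G := Finset.measurable_fun_sum _ fun a _ => (hF a).const_mul _
  have hnR : (0 : ℝ) < n := by exact_mod_cast hn
  have hint : ∫⁻ S, ENNReal.ofReal (G S) ∂μ ≤ ENNReal.ofReal (2 * √n) := by
    have e : ∀ S, ENNReal.ofReal (G S) = ∑ a, ENNReal.ofReal (w a) *
        ENNReal.ofReal (expDeviation n (D.real (A a)) #{k | S k ∈ A a}) := by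
      intro S
      rw [ENNReal.ofReal_sum_of_nonneg fun a _ => mul_nonneg (hw a) (expDeviation_nonneg ..)]
      exact sum_congr rfl fun a _ => ENNReal.ofReal_mul (hw a)
    simp only [e]
    rw [lintegral_finsetSum _ fun a _ => ((hF a).ennreal_ofReal).const_mul _]
    calc _ ≤ ∑ a, ENNReal.ofReal (w a) * ENNReal.ofReal (2 * √n) := by
          refine sum_le_sum fun a _ => ?_
          rw [lintegral_const_mul _ (hF a).ennreal_ofReal]
          gcongr
          exact lintegral_expDeviation_le D (hA a) hn
      _ = _ := by
          rw [← sum_mul, ← ENNReal.ofReal_sum_of_nonneg fun a _ => hw a, hw1, ENNReal.ofReal_one,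
            one_mul]
  have hC : 0 < 2 * √(n : ℝ) / δ := by positivity
  have hbad : μ {S | 2 * √n / δ ≤ G S} ≤ ENNReal.ofReal δ := by
    have h := meas_ge_le_lintegral_div (μ := μ) hG.ennreal_ofReal.aemeasurable
      (ENNReal.ofReal_pos.2 hC).ne' ENNReal.ofReal_ne_top
    calc μ {S | 2 * √n / δ ≤ G S}
        ≤ μ {S | ENNReal.ofReal (2 * √n / δ) ≤ ENNReal.ofReal (G S)} :=
          measure_mono fun S hS => ENNReal.ofReal_le_ofReal hS
      _ ≤ _ := h
      _ ≤ ENNReal.ofReal (2 * √n) / ENNReal.ofReal (2 * √n / δ) := by gcongr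
      _ = ENNReal.ofReal δ := by
          rw [← ENNReal.ofReal_div_of_pos hC]
          congr 1
          field_simp
  have hcompl : {S | G S < 2 * √n / δ} = {S | 2 * √n / δ ≤ G S}ᶜ := by
    ext S; simp
  rw [hcompl, prob_compl_eq_one_sub (measurableSet_le measurable_const hG),
    ENNReal.ofReal_sub _ hδ.le, ENNReal.ofReal_one]
  exact tsub_le_tsub_left hbad 1

lemma measurableSet_fst_ne_snd {X Y : Type*} [MeasurableSpace X] [MeasurableSpace Y]
    [MeasurableSingletonClass Y] [Finite Y] {f : X → Y} (hf : Measurable f) :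
    MeasurableSet {p : X × Y | f p.1 ≠ p.2} :=
  ((hf.comp measurable_fst).prodMk measurable_snd)
    (Set.toFinite {q : Y × Y | q.1 ≠ q.2}).measurableSet

lemma one_half_le_sum_of_majority {X Y H : Type*} [DecidableEq Y] [Fintype H] {hyp : H → X → Y}
    {ρ : H → ℝ} (hρ0 : ∀ i, 0 ≤ ρ i) (hρ1 : ∑ i, ρ i = 1) {x : X} {y z : Y} (hzy : z ≠ y)
    (hmaj : ∑ i, ρ i * (if hyp i x = y then (1 : ℝ) else 0) ≤
      ∑ i, ρ i * (if hyp i x = z then (1 : ℝ) else 0)) :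
    1 / 2 ≤ ∑ i, ρ i * (if hyp i x ≠ y then (1 : ℝ) else 0) := by
  have h1 : ∑ i, ρ i * (if hyp i x = z then (1 : ℝ) else 0) ≤
      ∑ i, ρ i * (if hyp i x ≠ y then (1 : ℝ) else 0) := by
    refine sum_le_sum fun i _ => mul_le_mul_of_nonneg_left ?_ (hρ0 i)
    by_cases h : hyp i x = z
    · simp [h, hzy]
    · rw [if_neg h]; split_ifs <;> norm_num
  have h2 : ∑ i, ρ i * (if hyp i x = y then (1 : ℝ) else 0) +
      ∑ i, ρ i * (if hyp i x ≠ y then (1 : ℝ) else 0) = 1 := by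
    rw [← sum_add_distrib]
    refine Eq.trans (sum_congr rfl fun i _ => ?_) hρ1
    by_cases h : hyp i x = y <;> simp [h]
  linarith

lemma majority_vote_loss_le_tandem {X Y H : Type*} [MeasurableSpace X] [MeasurableSpace Y]
    [MeasurableSingletonClass Y] [Finite Y] [DecidableEq Y] [Fintype H]
    (D : Measure (X × Y)) [IsProbabilityMeasure D] {hyp : H → X → Y}
    (hmeas : ∀ i, Measurable (hyp i)) {f : X → Y} (hf : Measurable f)
    {ρ : H → ℝ} (hρ0 : ∀ i, 0 ≤ ρ i) (hρ1 : ∑ i, ρ i = 1)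
    (hmaj : ∀ x y, ∑ i, ρ i * (if hyp i x = y then (1 : ℝ) else 0) ≤
      ∑ i, ρ i * (if hyp i x = f x then (1 : ℝ) else 0)) :
    D.real {p | f p.1 ≠ p.2} ≤ 4 * ∑ a : H × H, ρ a.1 * ρ a.2 *
      D.real {p | hyp a.1 p.1 ≠ p.2 ∧ hyp a.2 p.1 ≠ p.2} := by
  have hA : ∀ a : H × H, MeasurableSet {p : X × Y | hyp a.1 p.1 ≠ p.2 ∧ hyp a.2 p.1 ≠ p.2} :=
    fun a => (measurableSet_fst_ne_snd (hmeas a.1)).inter (measurableSet_fst_ne_snd (hmeas a.2))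
  have hM := measurableSet_fst_ne_snd hf
  have hI : ∀ {s : Set (X × Y)}, MeasurableSet s →
      Integrable (s.indicator (1 : X × Y → ℝ)) D := fun hs =>
    (integrable_const (1 : ℝ)).indicator hs
  simp only [← integral_indicator_one (hA _), ← integral_indicator_one hM, ← integral_const_mul]
  rw [← integral_finsetSum _ fun a _ => (hI (hA a)).const_mul _, ← integral_const_mul]
  refine integral_mono (hI hM)
    ((integrable_finsetSum _ fun a _ => (hI (hA a)).const_mul _).const_mul _) fun p => ?_
  have hsq : ∑ a : H × H, ρ a.1 * ρ a.2 *
      {p : X × Y | hyp a.1 p.1 ≠ p.2 ∧ hyp a.2 p.1 ≠ p.2}.indicator (1 : X × Y → ℝ) p =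
      (∑ i, ρ i * (if hyp i p.1 ≠ p.2 then (1 : ℝ) else 0)) ^ 2 := by
    rw [sq, sum_mul_sum, Fintype.sum_prod_type]
    refine sum_congr rfl fun i _ => sum_congr rfl fun j _ => ?_
    simp only [Set.indicator_apply, Set.mem_ofPred_eq, Pi.one_apply]
    by_cases hi : hyp i p.1 = p.2 <;> by_cases hj : hyp j p.1 = p.2 <;> simp [hi, hj]
  simp only [hsq]
  by_cases hp : f p.1 = p.2
  · rw [Set.indicator_of_notMem (by simpa using hp)]
    positivity
  · rw [Set.indicator_of_mem (by simpa using hp)]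
    have := one_half_le_sum_of_majority hρ0 hρ1 hp (hmaj p.1 p.2)
    simp only [Pi.one_apply]
    nlinarith

open MeasureTheory Finset

/-- PAC-Bayesian second order (tandem) bound: with probability at least `1 - δ` over an
i.i.d. sample of size `n`, simultaneously for all posteriors `ρ` and all `λ ∈ (0,2)`,
`L(MV_ρ) ≤ 4 (E_{ρ²}[L̂(h,h',S)]/(1 - λ/2) + (2 KL(ρ‖π) + ln(2√n/δ))/(λ (1
- λ/2) n))`. -/
theorem pac_bayes_tandem_bound
    {X Y H : Type*} [MeasurableSpace X] [MeasurableSpace Y] [MeasurableSingletonClass Y]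
    [Fintype Y] [Nonempty Y] [DecidableEq Y] [Fintype H]
    (D : Measure (X × Y)) [IsProbabilityMeasure D]
    (hyp : H → X → Y) (hmeas : ∀ i, Measurable (hyp i))
    (n : ℕ) (hn : 1 ≤ n)
    (π : H → ℝ) (hπ0 : ∀ i, 0 < π i) (hπ1 : ∑ i, π i = 1)
    (δ : ℝ) (hδ0 : 0 < δ) (hδ1 : δ < 1)
    (MV : (H → ℝ) → X → Y) (hMVmeas : ∀ ρ, Measurable (MV ρ))
    (hMV : ∀ ρ : H → ℝ, (∀ i, 0 ≤ ρ i) → (∑ i, ρ i) = 1 → ∀ x y,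
      (∑ i, ρ i * (if hyp i x = y then (1:ℝ) else 0)) ≤
        ∑ i, ρ i * (if hyp i x = MV ρ x then (1:ℝ) else 0)) :
    ENNReal.ofReal (1 - δ) ≤
      (Measure.pi fun _ : Fin n => D)
        {S : Fin n → X × Y |
          ∀ ρ : H → ℝ, (∀ i, 0 ≤ ρ i) → (∑ i, ρ i) = 1 →
            ∀ l : ℝ, 0 < l → l < 2 →
              (D {p : X × Y | MV ρ p.1 ≠ p.2}).toReal ≤
                4 * ((∑ i, ∑ j, ρ i * ρ j * ((n : ℝ)⁻¹ *
                      ∑ k, if hyp i (S k).1 ≠ (S k).2 ∧ hyp j (S k).1 ≠ (S k).2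
                        then (1:ℝ) else 0)) / (1 - l / 2) +
                    (2 * (∑ i, ρ i * Real.log (ρ i / π i)) +
                        Real.log (2 * Real.sqrt n / δ)) / (l * (1 - l / 2) * n))} := by
  classical
  set A : H × H → Set (X × Y) := fun a => {p | hyp a.1 p.1 ≠ p.2 ∧ hyp a.2 p.1 ≠ p.2} with hAdef
  have hA : ∀ a, MeasurableSet (A a) := fun a =>
    (measurableSet_fst_ne_snd (hmeas a.1)).inter (measurableSet_fst_ne_snd (hmeas a.2))
  have hw : ∀ a : H × H, 0 < π a.1 * π a.2 := fun a => mul_pos (hπ0 _) (hπ0 _)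
  have hprod : ∀ ρ : H → ℝ, ∑ i, ρ i = 1 → ∑ a : H × H, ρ a.1 * ρ a.2 = 1 := fun ρ h => by
    rw [Fintype.sum_prod_type, ← sum_mul_sum, h, one_mul]
  have hnR : (0 : ℝ) < n := by exact_mod_cast hn
  refine (le_measure_expDeviation_lt D hA hn (fun a => (hw a).le) (hprod π hπ1) hδ0).trans
    (measure_mono fun S hS ρ hρ0 hρ1 l hl0 hl2 => ?_)
  rw [Set.mem_ofPred_eq] at hS
  have hmv := majority_vote_loss_le_tandem D hmeas (hMVmeas ρ) hρ0 hρ1 (hMV ρ hρ0 hρ1)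
  set q : H × H → ℝ := fun a => ((#{k | S k ∈ A a} : ℕ) : ℝ) / n with hq
  have hdv := donsker_varadhan (r := fun a : H × H => ρ a.1 * ρ a.2)
    (g := fun a => n * (l * (D.real (A a) - q a) - l ^ 2 * D.real (A a) / 2))
    (fun a => mul_nonneg (hρ0 _) (hρ0 _)) (hprod ρ hρ1) hw
    (show 0 < 2 * √(n : ℝ) / δ by positivity)
    ((sum_le_sum fun a _ => mul_le_mul_of_nonneg_left
      (exp_linear_le_expDeviation n _ measureReal_nonneg hl0.le) (hw a).le).trans hS.le)
  rw [sum_mul_mul_log_div hρ1 hπ0] at hdv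
  set P := ∑ a : H × H, ρ a.1 * ρ a.2 * D.real (A a) with hP
  set Q := ∑ a : H × H, ρ a.1 * ρ a.2 * q a with hQ
  have hlin : ∑ a : H × H, ρ a.1 * ρ a.2 *
      (n * (l * (D.real (A a) - q a) - l ^ 2 * D.real (A a) / 2)) =
      n * l * (1 - l / 2) * P - n * l * Q := by
    rw [hP, hQ, mul_sum, mul_sum, ← sum_sub_distrib]
    exact sum_congr rfl fun a _ => by ring
  rw [hlin] at hdv
  have hemp : ∑ i, ∑ j, ρ i * ρ j * ((n : ℝ)⁻¹ *
      ∑ k, if hyp i (S k).1 ≠ (S k).2 ∧ hyp j (S k).1 ≠ (S k).2 then (1 : ℝ) else 0) = Q := by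
    rw [hQ, Fintype.sum_prod_type]
    refine sum_congr rfl fun i _ => sum_congr rfl fun j _ => ?_
    simp only [hq, hAdef, Set.mem_ofPred_eq, sum_boole]
    rw [inv_mul_eq_div]
  rw [hemp]
  refine hmv.trans (mul_le_mul_of_nonneg_left ?_ (by norm_num))
  have hl : 0 < 1 - l / 2 := by linarith
  set B := 2 * (∑ i, ρ i * Real.log (ρ i / π i)) + Real.log (2 * √n / δ)
  have hrhs : Q / (1 - l / 2) + B / (l * (1 - l / 2) * n) =
      (n * l * Q + B) / (l * (1 - l / 2) * n) := by field_simp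
  rw [hrhs, le_div_iff₀ (by positivity)]
  linarith
end

section
/- Equivalence of the C-tandem oracle bound with the C1 oracle bound in binary classification: in binary classification, writing L̄ = E_ρ[L(h)], T̄ = E_{ρ²}[L(h,h')], and D̄ = E_{ρ²}[𝔻(h,h')] (which satisfy T̄ = L̄ − D̄/2), if D̄ ≠ 1/2 then (T̄ − L̄²)/(T̄ − L̄ + 1/4) = 1 − (1 − 2L̄)²/(1 − 2D̄) = 1 − (1 − (2T̄ + D̄))²/(1 − 2D̄). -/
open MeasureTheory Finset

/-- In a two-element type, two values differ iff exactly one of them differs from a third. -/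
theorem ne_iff_xor_ne_of_card_eq_two {Y : Type*} [Fintype Y] (hY : Fintype.card Y = 2)
    (a b c : Y) : a ≠ b ↔ (a ≠ c ∧ ¬ b ≠ c) ∨ (b ≠ c ∧ ¬ a ≠ c) := by
  classical
  have h : ¬ (a ≠ b ∧ a ≠ c ∧ b ≠ c) := fun habc => by
    have := Finset.card_le_univ ({a, b, c} : Finset Y)
    rw [Finset.card_eq_three.2 ⟨a, b, c, habc.1, habc.2.1, habc.2.2, rfl⟩, hY] at this
    omega
  grind

theorem measureReal_symmDiff_add_two_mul_inter {Ω : Type*} [MeasurableSpace Ω]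
    (μ : Measure Ω) [IsFiniteMeasure μ] {A B : Set Ω} (hA : MeasurableSet A)
    (hB : MeasurableSet B) :
    μ.real (symmDiff A B) + 2 * μ.real (A ∩ B) = μ.real A + μ.real B := by
  have h := measureReal_symmDiff_eq (μ := μ) hA hB
  have h1 := measureReal_inter_add_sdiff (μ := μ) (s := A) hB
  have h2 := measureReal_inter_add_sdiff (μ := μ) (s := B) hA
  rw [Set.inter_comm B A] at h2
  linarith

/-- In binary classification the disagreement of `f` and `g` plus twice their tandem loss is the
sum of their losses. -/
theorem disagreement_add_two_mul_tandem
    {X Y : Type*} [MeasurableSpace X] [MeasurableSpace Y] [MeasurableSingletonClass Y]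
    [Fintype Y] (hY : Fintype.card Y = 2) (D : Measure (X × Y)) [IsFiniteMeasure D]
    {f g : X → Y} (hf : Measurable f) (hg : Measurable g) :
    D.real {p : X × Y | f p.1 ≠ g p.1} + 2 * D.real {p : X × Y | f p.1 ≠ p.2 ∧ g p.1 ≠ p.2} =
      D.real {p : X × Y | f p.1 ≠ p.2} + D.real {p : X × Y | g p.1 ≠ p.2} := by
  have hmeas {h : X → Y} (hh : Measurable h) : MeasurableSet {p : X × Y | h p.1 ≠ p.2} :=
    (measurableSet_eq_fun (hh.comp measurable_fst) measurable_snd).compl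
  rw [← measureReal_symmDiff_add_two_mul_inter D (hmeas hf) (hmeas hg)]
  congr 2
  ext p
  exact ne_iff_xor_ne_of_card_eq_two hY _ _ p.2

/-- A weighted average over pairs of a sum of marginals is the sum of the weighted averages. -/
theorem sum_sum_mul_add_of_sum_eq_one {ι : Type*} [Fintype ι] (ρ l : ι → ℝ)
    (hρ : ∑ i, ρ i = 1) : ∑ i, ∑ j, ρ i * ρ j * (l i + l j) = 2 * ∑ i, ρ i * l i := by
  have h (i j : ι) : ρ i * ρ j * (l i + l j) = ρ i * l i * ρ j + ρ i * (ρ j * l j) := by ring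
  simp_rw [h, sum_add_distrib, ← mul_sum, ← sum_mul, hρ]
  ring

/-- Equivalence of the C-tandem oracle bound with the C1 and C2 oracle bounds in binary
classification: with `L̄ = E_ρ[L(h)]`, `T̄ = E_{ρ²}[L(h,h')]` and `D̄ = E_{ρ²}[𝔻(h,h')]`,
if `D̄ ≠ 1/2` then
`(T̄ - L̄²)/(T̄ - L̄ + 1/4) = 1 - (1 - 2L̄)²/(1 - 2D̄) = 1 - (1 - (2T̄ + D̄))²/(1 - 2D̄)`. -/
theorem c_tandem_eq_c1_eq_c2_binary
    {X Y H : Type*} [MeasurableSpace X] [MeasurableSpace Y] [MeasurableSingletonClass Y]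
    [Fintype Y] (hY : Fintype.card Y = 2) [DecidableEq Y] [Fintype H]
    (D : Measure (X × Y)) [IsProbabilityMeasure D]
    (hyp : H → X → Y) (hmeas : ∀ i, Measurable (hyp i))
    (ρ : H → ℝ) (hρ0 : ∀ i, 0 ≤ ρ i) (hρ1 : ∑ i, ρ i = 1)
    (Lbar Tbar Dbar : ℝ)
    (hL : Lbar = ∑ i, ρ i * (D {p : X × Y | hyp i p.1 ≠ p.2}).toReal)
    (hT : Tbar = ∑ i, ∑ j, ρ i * ρ j *
      (D {p : X × Y | hyp i p.1 ≠ p.2 ∧ hyp j p.1 ≠ p.2}).toReal)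
    (hD : Dbar = ∑ i, ∑ j, ρ i * ρ j *
      (D {p : X × Y | hyp i p.1 ≠ hyp j p.1}).toReal)
    (hDbar : Dbar ≠ 1/2) :
    (Tbar - Lbar^2) / (Tbar - Lbar + 1/4) = 1 - (1 - 2*Lbar)^2 / (1 - 2*Dbar) ∧
      1 - (1 - 2*Lbar)^2 / (1 - 2*Dbar) =
        1 - (1 - (2*Tbar + Dbar))^2 / (1 - 2*Dbar) := by
  have hLTD : Dbar + 2 * Tbar = 2 * Lbar := by
    rw [hL, hT, hD, ← sum_sum_mul_add_of_sum_eq_one ρ _ hρ1, mul_sum, ← sum_add_distrib]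
    refine sum_congr rfl fun i _ => ?_
    rw [mul_sum, ← sum_add_distrib]
    refine sum_congr rfl fun j _ => ?_
    have h := disagreement_add_two_mul_tandem hY D (hmeas i) (hmeas j)
    simp only [measureReal_def] at h
    rw [← h]
    ring
  obtain rfl : Tbar = Lbar - Dbar / 2 := by linarith
  have hne : 1 - 2 * Dbar ≠ 0 := fun h => hDbar (by linarith)
  refine ⟨?_, by ring⟩
  rw [show Lbar - Dbar / 2 - Lbar + 1 / 4 = (1 - 2 * Dbar) / 4 by ring,
    div_div_eq_mul_div, one_sub_div hne]
  congr 1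
  ring
end

section
/- Equivalence of the C-tandem oracle bound with the ω-margin form of the oracle C-bound: in multiclass classification, define the (1/2)-margin M_{ρ,1/2}(x,y) = Σ_{h∈H} ρ(h)·1[h(x)=y] − 1/2. Then E_D[M_{ρ,1/2}(X,Y)] = 1/2 − E_ρ[L(h)] and E_D[M_{ρ,1/2}(X,Y)²] = E_{ρ²}[L(h,h')] − E_ρ[L(h)] + 1/4, and consequently, whenever E_D[M_{ρ,1/2}(X,Y)²] ≠ 0, (E_{ρ²}[L(h,h')] − E_ρ[L(h)]²)/(E_{ρ²}[L(h,h')] − E_ρ[L(h)] + 1/4) = 1 − (E_D[M_{ρ,1/2}(X,Y)])² / E_D[M_{ρ,1/2}(X,Y)²]. -/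
open MeasureTheory Finset

/-- The event that a measurable hypothesis misclassifies is measurable. -/
theorem measurableSet_misclassified {X Y : Type*} [MeasurableSpace X] [MeasurableSpace Y]
    [MeasurableSingletonClass Y] [Countable Y] {h : X → Y} (hh : Measurable h) :
    MeasurableSet {p : X × Y | h p.1 ≠ p.2} :=
  (measurableSet_eq_fun (hh.comp measurable_fst) measurable_snd).compl

/-- The expectation of a finite linear combination of indicators of events. -/
theorem integral_sum_mul_indicator_one {Ω ι : Type*} [MeasurableSpace Ω] [Fintype ι]
    (μ : Measure Ω) [IsFiniteMeasure μ] (c : ι → ℝ) {A : ι → Set Ω}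
    (hA : ∀ i, MeasurableSet (A i)) :
    Integrable (fun ω => ∑ i, c i * (A i).indicator (fun _ => (1 : ℝ)) ω) μ ∧
      ∫ ω, ∑ i, c i * (A i).indicator (fun _ => (1 : ℝ)) ω ∂μ = ∑ i, c i * (μ (A i)).toReal := by
  have hint : ∀ i, Integrable (fun ω => c i * (A i).indicator (fun _ => (1 : ℝ)) ω) μ :=
    fun i => ((integrable_const 1).indicator (hA i)).const_mul _
  refine ⟨integrable_finsetSum _ fun i _ => hint i, ?_⟩
  rw [integral_finsetSum _ fun i _ => hint i]
  refine Finset.sum_congr rfl fun i _ => ?_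
  rw [integral_const_mul, integral_indicator_const _ (hA i)]
  simp [Measure.real]

/-- Equivalence of the C-tandem oracle bound with the ω-margin form of the oracle
C-bound (ω = 1/2): the first and second moments of the margin
`M_{ρ,1/2}(x,y) = Σ_h ρ(h) 1[h(x)=y] - 1/2` satisfy
`E_D[M] = 1/2 - E_ρ[L(h)]` and `E_D[M²] = E_{ρ²}[L(h,h')] - E_ρ[L(h)] + 1/4`, and
consequently, whenever `E_D[M²] ≠ 0`, the C-tandem expression equals `1 - E_D[M]²/E_D[M²]`. -/
theorem c_tandem_eq_margin_form
    {X Y H : Type*} [MeasurableSpace X] [MeasurableSpace Y] [MeasurableSingletonClass Y]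
    [Fintype Y] [Nonempty Y] [DecidableEq Y] [Fintype H]
    (D : Measure (X × Y)) [IsProbabilityMeasure D]
    (hyp : H → X → Y) (hmeas : ∀ i, Measurable (hyp i))
    (ρ : H → ℝ) (hρ0 : ∀ i, 0 ≤ ρ i) (hρ1 : ∑ i, ρ i = 1) :
    (∫ p, ((∑ i, ρ i * (if hyp i p.1 = p.2 then (1:ℝ) else 0)) - 1/2) ∂D =
        1/2 - ∑ i, ρ i * (D {p : X × Y | hyp i p.1 ≠ p.2}).toReal) ∧
    (∫ p, ((∑ i, ρ i * (if hyp i p.1 = p.2 then (1:ℝ) else 0)) - 1/2)^2 ∂D =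
        (∑ i, ∑ j, ρ i * ρ j *
            (D {p : X × Y | hyp i p.1 ≠ p.2 ∧ hyp j p.1 ≠ p.2}).toReal) -
          (∑ i, ρ i * (D {p : X × Y | hyp i p.1 ≠ p.2}).toReal) + 1/4) ∧
    ((∫ p, ((∑ i, ρ i * (if hyp i p.1 = p.2 then (1:ℝ) else 0)) - 1/2)^2 ∂D) ≠ 0 →
      ((∑ i, ∑ j, ρ i * ρ j *
            (D {p : X × Y | hyp i p.1 ≠ p.2 ∧ hyp j p.1 ≠ p.2}).toReal) -
          (∑ i, ρ i * (D {p : X × Y | hyp i p.1 ≠ p.2}).toReal)^2) /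
        ((∑ i, ∑ j, ρ i * ρ j *
            (D {p : X × Y | hyp i p.1 ≠ p.2 ∧ hyp j p.1 ≠ p.2}).toReal) -
          (∑ i, ρ i * (D {p : X × Y | hyp i p.1 ≠ p.2}).toReal) + 1/4) =
        1 - (∫ p, ((∑ i, ρ i * (if hyp i p.1 = p.2 then (1:ℝ) else 0)) - 1/2) ∂D)^2 /
          (∫ p, ((∑ i, ρ i * (if hyp i p.1 = p.2 then (1:ℝ) else 0)) - 1/2)^2 ∂D)) := by
  have hA : ∀ i, MeasurableSet {p : X × Y | hyp i p.1 ≠ p.2} :=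
    fun i => measurableSet_misclassified (hmeas i)
  obtain ⟨hint₁, hval₁⟩ := integral_sum_mul_indicator_one D ρ hA
  obtain ⟨hint₂, hval₂⟩ := integral_sum_mul_indicator_one D (fun k : H × H => ρ k.1 * ρ k.2)
    (A := fun k => {p : X × Y | hyp k.1 p.1 ≠ p.2 ∧ hyp k.2 p.1 ≠ p.2})
    fun k => (hA k.1).inter (hA k.2)
  rw [Fintype.sum_prod_type] at hval₂
  have margin_eq : ∀ p : X × Y,
      (∑ i, ρ i * (if hyp i p.1 = p.2 then (1:ℝ) else 0)) - 1/2 =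
        1/2 - ∑ i, ρ i * {p : X × Y | hyp i p.1 ≠ p.2}.indicator (fun _ => (1 : ℝ)) p := by
    intro p
    have : (∑ i, ρ i * (if hyp i p.1 = p.2 then (1:ℝ) else 0)) +
        ∑ i, ρ i * {p : X × Y | hyp i p.1 ≠ p.2}.indicator (fun _ => (1 : ℝ)) p = 1 := by
      rw [← Finset.sum_add_distrib]
      refine (Finset.sum_congr rfl fun i _ => ?_).trans hρ1
      by_cases h : hyp i p.1 = p.2 <;> simp [h]
    linarith
  have sq_error_eq : ∀ p : X × Y,
      (∑ i, ρ i * {p : X × Y | hyp i p.1 ≠ p.2}.indicator (fun _ => (1 : ℝ)) p) ^ 2 =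
        ∑ k : H × H, ρ k.1 * ρ k.2 *
          {p : X × Y | hyp k.1 p.1 ≠ p.2 ∧ hyp k.2 p.1 ≠ p.2}.indicator (fun _ => (1 : ℝ)) p := by
    intro p
    rw [sq, Finset.sum_mul_sum, Fintype.sum_prod_type]
    refine Finset.sum_congr rfl fun i _ => Finset.sum_congr rfl fun j _ => ?_
    by_cases hi : hyp i p.1 = p.2 <;> by_cases hj : hyp j p.1 = p.2 <;> simp [hi, hj]
  have sq_margin_eq : ∀ p : X × Y,
      ((∑ i, ρ i * (if hyp i p.1 = p.2 then (1:ℝ) else 0)) - 1/2) ^ 2 =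
        (∑ k : H × H, ρ k.1 * ρ k.2 *
          {p : X × Y | hyp k.1 p.1 ≠ p.2 ∧ hyp k.2 p.1 ≠ p.2}.indicator (fun _ => (1 : ℝ)) p) -
        (∑ i, ρ i * {p : X × Y | hyp i p.1 ≠ p.2}.indicator (fun _ => (1 : ℝ)) p) + 1/4 := by
    intro p
    rw [margin_eq, ← sq_error_eq]
    ring
  have first_moment : ∫ p, ((∑ i, ρ i * (if hyp i p.1 = p.2 then (1:ℝ) else 0)) - 1/2) ∂D =
      1/2 - ∑ i, ρ i * (D {p : X × Y | hyp i p.1 ≠ p.2}).toReal := by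
    rw [integral_congr_ae (.of_forall margin_eq), integral_sub (integrable_const _) hint₁, hval₁]
    simp
  have second_moment :
      ∫ p, ((∑ i, ρ i * (if hyp i p.1 = p.2 then (1:ℝ) else 0)) - 1/2)^2 ∂D =
        (∑ i, ∑ j, ρ i * ρ j *
            (D {p : X × Y | hyp i p.1 ≠ p.2 ∧ hyp j p.1 ≠ p.2}).toReal) -
          (∑ i, ρ i * (D {p : X × Y | hyp i p.1 ≠ p.2}).toReal) + 1/4 := by
    rw [integral_congr_ae (.of_forall sq_margin_eq),
      integral_add ?_ (integrable_const _), integral_sub hint₂ hint₁, hval₁, hval₂]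
    · simp
    · exact hint₂.sub hint₁
  refine ⟨first_moment, second_moment, fun hne => ?_⟩
  rw [second_moment] at hne
  rw [first_moment, second_moment, eq_sub_iff_add_eq, ← add_div, div_eq_one_iff_eq hne]
  ring
end
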